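/- arXiv:q-alg/9603010 — 2 statements merged into one kernel-verified Lean document; each statement's English description precedes it below -/
import Mathlib

section
/- Let Γ_x be a V-oriented Wilson graph with exactly one 4-valent vertex x and all other vertices trivalent. Then, up to equivalence of pairs (where two pairs (Γ,e), (Γ',e') are equivalent if some isomorphism of V-oriented Wilson graphs Γ → Γ' carries e to e'), there are at most three pairs (Γ, e) consisting of a trivalent V-oriented Wilson graph Γ and an admissible edge e ∈ E_Γ such that δ_eΓ = Γ_x. -/
/- ## Core: labelled Wilson diagrams (trivalent or with one 4-valent vertex),
   encoded by an "anchor" equivalence between edge-slots and vertex/component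
   coordinates.  External vertices are labelled `Fin n` cyclically along the
   oriented Wilson line, internal vertices by `Fin t`.  Only non-Wilson edges
   are recorded (Wilson edges are the implicit arcs between consecutive
   external labels).  The anchor encodes both the valences and a representative
   of the vertex orientation (V-orientation). -/

noncomputable section

open scoped BigOperators

/-- slot-count of a trivalent Wilson graph: each external vertex carries one
non-Wilson edge-end, each internal vertex three. -/
def triBound (n t : ℕ) : Fin n ⊕ Fin t → ℕ := fun v =>
  match v with
  | .inl _ => 1
  | .inr _ => 3

/-- slot-count of a Wilson graph with a single 4-valent vertex `m`
(all other vertices trivalent). -/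
def quadBound (n t : ℕ) (m : Fin n ⊕ Fin t) : Fin n ⊕ Fin t → ℕ := fun v =>
  if v = m then (match m with | .inl _ => 2 | .inr _ => 4) else triBound n t v

/-- A (V-oriented) Wilson diagram with `n` external and `t` internal vertices and
slot-counts `bd`.  `anch` sends each end `(e, b)` of a non-Wilson edge `e` to the
vertex it is attached to, together with its position in the V-orientation order
of the non-Wilson edge-ends at that vertex. -/
structure BDiag (n t : ℕ) (bd : Fin n ⊕ Fin t → ℕ) where
  E : Type
  [fE : Fintype E]
  [dE : DecidableEq E]
  anch : E × Bool ≃ ((v : Fin n ⊕ Fin t) × Fin (bd v))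
  npos : 0 < n
  /-- connectivity (through non-Wilson edges together with the Wilson line) -/
  conn : (SimpleGraph.fromRel (fun u v =>
      (∃ (e : E) (b : Bool), (anch (e, b)).1 = u ∧ (anch (e, !b)).1 = v) ∨
      (∃ i j : Fin n, u = Sum.inl i ∧ v = Sum.inl j ∧ (i.val + 1) % n = j.val))).Connected

attribute [instance] BDiag.fE BDiag.dE

/-- the vertex at which the end `(e,b)` is attached. -/
def BDiag.ep {n t : ℕ} {bd : Fin n ⊕ Fin t → ℕ} (Γ : BDiag n t bd) (e : Γ.E) (b : Bool) :
    Fin n ⊕ Fin t := (Γ.anch (e, b)).1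

/-- the V-orientation position of the end `(e,b)` at its vertex. -/
def BDiag.cmp {n t : ℕ} {bd : Fin n ⊕ Fin t → ℕ} (Γ : BDiag n t bd) (e : Γ.E) (b : Bool) :
    ℕ := ((Γ.anch (e, b)).2 : ℕ)

/-- trivalent V-oriented Wilson diagrams. -/
abbrev Tri (n t : ℕ) := BDiag n t (triBound n t)

/-- relabelling of vertices by a rotation `k` of the Wilson line and a
permutation `π` of the internal vertices. -/
def vmap {n t : ℕ} (k : Fin n) (π : Equiv.Perm (Fin t)) :
    Fin n ⊕ Fin t → Fin n ⊕ Fin t := Sum.map (· + k) π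

/-- Isomorphisms of (V-oriented) Wilson diagrams: a bijection `ψ` of edges with
end-flips `fl`, a rotation `k` of the Wilson line (preserving its orientation),
a permutation `π` of internal vertices, and for each vertex a permutation `ρ`
of the local V-orientation orders. -/
structure BIso {n t : ℕ} {bd bd' : Fin n ⊕ Fin t → ℕ}
    (Γ : BDiag n t bd) (Γ' : BDiag n t bd') where
  ψ : Γ.E ≃ Γ'.E
  fl : Γ.E → Bool
  k : Fin n
  π : Equiv.Perm (Fin t)
  ρ : (v : Fin n ⊕ Fin t) → Fin (bd v) ≃ Fin (bd' (vmap k π v))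
  hanch : ∀ (e : Γ.E) (b : Bool),
    Γ'.anch (ψ e, xor (fl e) b) =
      ⟨vmap k π (Γ.anch (e, b)).1, ρ (Γ.anch (e, b)).1 (Γ.anch (e, b)).2⟩

/-- the sign comparing the V-orientation of the target with the V-orientation
induced by the isomorphism (product over all vertices of the signatures of the
local reorderings). -/
noncomputable def BIso.sign {n t : ℕ} {bd bd' : Fin n ⊕ Fin t → ℕ}
    {Γ : BDiag n t bd} {Γ' : BDiag n t bd'} (φ : BIso Γ Γ') : ℤˣ :=
  ∏ v : Fin n ⊕ Fin t, Equiv.Perm.sign ((φ.ρ v).trans (finCongr (by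
    simpa using (Fintype.card_congr (φ.ρ v)).symm)))

/-- Automorphisms of the underlying Wilson graph (forgetting V-orientations):
pairs `(ρ, σ)` of a vertex bijection preserving the oriented Wilson line and an
edge bijection intertwining the boundary maps. -/
structure GAuto {n t : ℕ} {bd : Fin n ⊕ Fin t → ℕ} (Γ : BDiag n t bd) where
  ψ : Equiv.Perm Γ.E
  k : Fin n
  π : Equiv.Perm (Fin t)
  hep : ∀ e : Γ.E,
    (Γ.ep (ψ e) false = vmap k π (Γ.ep e false) ∧ Γ.ep (ψ e) true = vmap k π (Γ.ep e true)) ∨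
    (Γ.ep (ψ e) false = vmap k π (Γ.ep e true) ∧ Γ.ep (ψ e) true = vmap k π (Γ.ep e false))

/-- Isomorphisms of the underlying Wilson graphs (not respecting V-orientation). -/
structure UIso {n t : ℕ} {bd bd' : Fin n ⊕ Fin t → ℕ}
    (Γ : BDiag n t bd) (Γ' : BDiag n t bd') where
  ψ : Γ.E ≃ Γ'.E
  fl : Γ.E → Bool
  k : Fin n
  π : Equiv.Perm (Fin t)
  hep : ∀ (e : Γ.E) (b : Bool), Γ'.ep (ψ e) (xor (fl e) b) = vmap k π (Γ.ep e b)

/-- the interior of a Wilson diagram, as a simple graph on its vertices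
(adjacency through non-Wilson edges only). -/
def intG {n t : ℕ} {bd : Fin n ⊕ Fin t → ℕ} (Γ : BDiag n t bd) :
    SimpleGraph (Fin n ⊕ Fin t) :=
  SimpleGraph.fromRel (fun u v => ∃ (e : Γ.E) (b : Bool), Γ.ep e b = u ∧ Γ.ep e (!b) = v)

end
/- ## Collapse of an admissible edge of a trivalent Wilson diagram onto a
   diagram with one 4-valent vertex (the graphs `δ_e Γ`), with the induced
   V-orientation (figs. 5-7 of Altschuler-Freidel), stated as predicates. -/

noncomputable section

/-- induced V-orientation position at the new 4-valent internal vertex, for the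
collapse of an internal edge `e` with ends at `uu`, `vv` (concatenation of the
cyclic orders at the two endpoints of `e`, starting after `e`). -/
def indCmpInt {n t : ℕ} (Γ : Tri n (t+1)) (e : Γ.E) (uu vv : Fin (t+1))
    (f : Γ.E) (b : Bool) : ℕ :=
  if Γ.ep f b = Sum.inr uu then (Γ.cmp f b + 3 - Γ.cmp e false) % 3 - 1
  else if Γ.ep f b = Sum.inr vv then (Γ.cmp f b + 3 - Γ.cmp e true) % 3 + 1
  else Γ.cmp f b

/-- Collapse of a non-Wilson edge `e` of `Γ` joining two internal vertices
`uu ≠ vv`, producing `Δ` (which has a distinguished 4-valent internal vertex).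
The V-orientation of `Δ` agrees with the induced one up to an even correction. -/
structure CollapseInt {n t : ℕ} {m : Fin n ⊕ Fin t} (Γ : Tri n (t+1)) (e : Γ.E)
    (Δ : BDiag n t (quadBound n t m)) where
  uu : Fin (t+1)
  vv : Fin (t+1)
  hu : Γ.ep e false = Sum.inr uu
  hv : Γ.ep e true = Sum.inr vv
  hne : uu ≠ vv
  x : Fin t
  hm : m = Sum.inr x
  μ : Fin (t+1) → Fin t
  hμu : μ uu = x
  hμv : μ vv = x
  hinj : ∀ a b : Fin (t+1), a ≠ vv → b ≠ vv → μ a = μ b → a = b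
  hsurj : Function.Surjective μ
  k : Fin n
  φE : {f : Γ.E // f ≠ e} ≃ Δ.E
  g : Γ.E → Bool
  hep : ∀ (f : {f : Γ.E // f ≠ e}) (b : Bool),
    Δ.ep (φE f) (xor (g f.1) b) = Sum.map (· + k) μ (Γ.ep f.1 b)
  ρ : (v : Fin n ⊕ Fin t) → Equiv.Perm (Fin (quadBound n t m v))
  hsgn : ∏ v : Fin n ⊕ Fin t, Equiv.Perm.sign (ρ v) = 1
  hcmp : ∀ (f : {f : Γ.E // f ≠ e}) (b : Bool),
    ∃ h : indCmpInt Γ e uu vv f.1 b <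
        quadBound n t m (Sum.map (· + k) μ (Γ.ep f.1 b)),
      Δ.cmp (φE f) (xor (g f.1) b) =
        ((ρ (Sum.map (· + k) μ (Γ.ep f.1 b))) ⟨indCmpInt Γ e uu vv f.1 b, h⟩ : Fin _).val

/-- induced V-orientation position for the collapse of a non-Wilson edge with
one external endpoint (fig. 6). -/
def indCmpMix {n t : ℕ} (Γ : Tri n (t+1)) (e : Γ.E) (be : Bool) (vv : Fin (t+1))
    (f : Γ.E) (b : Bool) : ℕ :=
  if Γ.ep f b = Sum.inr vv then (Γ.cmp f b + 3 - Γ.cmp e (!be)) % 3 - 1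
  else Γ.cmp f b

/-- vertex map for the collapse of an edge with an external endpoint `iu` and an
internal endpoint `vv`: `vv` is merged into the (rotated) external vertex `x`. -/
def vmapMix {n t : ℕ} (k : Fin n) (μ : Fin (t+1) → Fin t) (vv : Fin (t+1)) (x : Fin n) :
    Fin n ⊕ Fin (t+1) → Fin n ⊕ Fin t := fun w =>
  if w = Sum.inr vv then Sum.inl x else Sum.map (· + k) μ w

/-- Collapse of a non-Wilson edge `e` of `Γ` with one external endpoint `iu` and
one internal endpoint `vv`, producing `Δ` (with a distinguished 4-valent
external vertex). -/
structure CollapseMix {n t : ℕ} {m : Fin n ⊕ Fin t} (Γ : Tri n (t+1)) (e : Γ.E)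
    (Δ : BDiag n t (quadBound n t m)) where
  be : Bool
  iu : Fin n
  vv : Fin (t+1)
  hu : Γ.ep e be = Sum.inl iu
  hv : Γ.ep e (!be) = Sum.inr vv
  x : Fin n
  k : Fin n
  hx : iu + k = x
  hm : m = Sum.inl x
  μ : Fin (t+1) → Fin t
  hinj : ∀ a b : Fin (t+1), a ≠ vv → b ≠ vv → μ a = μ b → a = b
  hsurj : Function.Surjective μ
  φE : {f : Γ.E // f ≠ e} ≃ Δ.E
  g : Γ.E → Bool
  hep : ∀ (f : {f : Γ.E // f ≠ e}) (b : Bool),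
    Δ.ep (φE f) (xor (g f.1) b) = vmapMix k μ vv x (Γ.ep f.1 b)
  ρ : (v : Fin n ⊕ Fin t) → Equiv.Perm (Fin (quadBound n t m v))
  hsgn : ∏ v : Fin n ⊕ Fin t, Equiv.Perm.sign (ρ v) = 1
  hcmp : ∀ (f : {f : Γ.E // f ≠ e}) (b : Bool),
    ∃ h : indCmpMix Γ e be vv f.1 b <
        quadBound n t m (vmapMix k μ vv x (Γ.ep f.1 b)),
      Δ.cmp (φE f) (xor (g f.1) b) =
        ((ρ (vmapMix k μ vv x (Γ.ep f.1 b))) ⟨indCmpMix Γ e be vv f.1 b, h⟩ : Fin _).val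

/-- induced V-orientation position for the collapse of the Wilson edge joining
the consecutive external vertices `i0`, `i0+1` (fig. 7: the two non-Wilson ends
at the new 4-valent external vertex are ordered along the Wilson orientation). -/
def indCmpWil {n t : ℕ} (Γ : Tri (n+1) t) (i0 : Fin (n+1)) (f : Γ.E) (b : Bool) : ℕ :=
  if Γ.ep f b = Sum.inl i0 then 0
  else if Γ.ep f b = Sum.inl (i0 + 1) then 1
  else Γ.cmp f b

/-- Collapse of the Wilson edge of `Γ` joining the consecutive external vertices
`i0` and `i0+1`, producing `Δ` (with a distinguished 4-valent external vertex). -/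
structure CollapseWil {n t : ℕ} {m : Fin n ⊕ Fin t} (Γ : Tri (n+1) t) (i0 : Fin (n+1))
    (Δ : BDiag n t (quadBound n t m)) where
  x : Fin n
  hm : m = Sum.inl x
  ν : Fin (n+1) → Fin n
  hν0 : ν i0 = x
  hν1 : ν (i0 + 1) = x
  hνsucc : ∀ a : Fin (n+1), a ≠ i0 → (ν (a + 1)).val = ((ν a).val + 1) % n
  φE : Γ.E ≃ Δ.E
  g : Γ.E → Bool
  hep : ∀ (f : Γ.E) (b : Bool),
    Δ.ep (φE f) (xor (g f) b) = Sum.map ν id (Γ.ep f b)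
  ρ : (v : Fin n ⊕ Fin t) → Equiv.Perm (Fin (quadBound n t m v))
  hsgn : ∏ v : Fin n ⊕ Fin t, Equiv.Perm.sign (ρ v) = 1
  hcmp : ∀ (f : Γ.E) (b : Bool),
    ∃ h : indCmpWil Γ i0 f b < quadBound n t m (Sum.map ν id (Γ.ep f b)),
      Δ.cmp (φE f) (xor (g f) b) =
        ((ρ (Sum.map ν id (Γ.ep f b))) ⟨indCmpWil Γ i0 f b, h⟩ : Fin _).val

/- ### Packaging over all sizes -/

/-- trivalent V-oriented Wilson diagrams of arbitrary size. -/
def TriS := Σ p : ℕ × ℕ, Tri p.1 p.2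

/-- a trivalent diagram with a distinguished admissible-edge token: either a
non-Wilson edge, or the Wilson edge at position `i` (joining the external
vertices `i` and `i+1`). -/
def Pair (p : ℕ × ℕ) := Σ Γ : Tri p.1 p.2, (Γ.E ⊕ Fin p.1)

/-- pairs `(Γ, e)` of arbitrary size. -/
def SPair := Σ p : ℕ × ℕ, Pair p

/-- Wilson diagrams with one 4-valent vertex, of arbitrary size. -/
def QuadS := Σ (p : ℕ × ℕ) (m : Fin p.1 ⊕ Fin p.2), BDiag p.1 p.2 (quadBound p.1 p.2 m)

def castPair {p q : ℕ × ℕ} (h : p = q) (P : Pair p) : Pair q :=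
  cast (congrArg Pair h) P

def castTri {p q : ℕ × ℕ} (h : p = q) (Γ : Tri p.1 p.2) : Tri q.1 q.2 :=
  cast (congrArg (fun r : ℕ × ℕ => Tri r.1 r.2) h) Γ

def castQuad {p q : ℕ × ℕ} (h : p = q)
    (Q : Σ m : Fin p.1 ⊕ Fin p.2, BDiag p.1 p.2 (quadBound p.1 p.2 m)) :
    Σ m : Fin q.1 ⊕ Fin q.2, BDiag q.1 q.2 (quadBound q.1 q.2 m) :=
  cast (congrArg (fun r : ℕ × ℕ =>
    Σ m : Fin r.1 ⊕ Fin r.2, BDiag r.1 r.2 (quadBound r.1 r.2 m)) h) Q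

/-- equivalence of pairs `(Γ, e)`, via an isomorphism of V-oriented Wilson
diagrams of orientation-sign `ε` carrying the token of the first to the token
of the second. -/
def PairEquivSg (ε : ℤˣ) (P Q : SPair) : Prop :=
  ∃ h : P.1 = Q.1, ∃ φ : BIso (castPair h P.2).1 Q.2.1,
    φ.sign = ε ∧ Sum.map φ.ψ (· + φ.k) (castPair h P.2).2 = Q.2.2

/-- equivalence of pairs by an orientation-preserving isomorphism. -/
def PairEquivS (P Q : SPair) : Prop := PairEquivSg 1 P Q

/-- `CollPair P Q` : collapsing the token edge of the pair `P` yields the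
one-4-valent-vertex diagram `Q` (i.e. `δ_e Γ = Γ_x`). -/
def CollPair (P : SPair) (Q : QuadS) : Prop :=
  (∃ h : P.1 = (Q.1.1, Q.1.2 + 1),
    (match castPair h P.2 with
     | ⟨Γ, .inl e⟩ => Nonempty (CollapseInt Γ e Q.2.2) ∨ Nonempty (CollapseMix Γ e Q.2.2)
     | ⟨_, .inr _⟩ => False)) ∨
  (∃ h : P.1 = (Q.1.1 + 1, Q.1.2),
    (match castPair h P.2 with
     | ⟨Γ, .inr i0⟩ => Nonempty (CollapseWil Γ i0 Q.2.2)
     | ⟨_, .inl _⟩ => False))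

/-- isomorphism of one-4-valent-vertex diagrams with orientation-sign `ε`. -/
def QIsoSg (ε : ℤˣ) (Q Q' : QuadS) : Prop :=
  ∃ h : Q.1 = Q'.1, ∃ φ : BIso (castQuad h Q.2).2 Q'.2.2, φ.sign = ε

/-- isomorphism of the underlying (unoriented) Wilson graphs. -/
def UIsoS (Q Q' : QuadS) : Prop :=
  ∃ h : Q.1 = Q'.1, Nonempty (UIso (castQuad h Q.2).2 Q'.2.2)

/-- isomorphism of trivalent diagrams (of arbitrary sizes) of sign `ε`. -/
def TriIsoSg (ε : ℤˣ) (x y : TriS) : Prop :=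
  ∃ h : x.1 = y.1, ∃ φ : BIso (castTri h x.2) y.2, φ.sign = ε

/- ### Typed lifts: the ≤ 3 splittings of a 4-valent vertex are distinguished
   by the way the four (resp. two) slots at the 4-valent vertex are divided
   between the two endpoints of the collapsed edge. -/

/-- an internal-edge collapse in which the slots at the 4-valent vertex coming
from the `uu`-side are exactly those with positions in `S`. -/
def CollapseIntT {n t : ℕ} {m : Fin n ⊕ Fin t} (S : Finset (Fin 4))
    (Γ : Tri n (t+1)) (e : Γ.E) (Δ : BDiag n t (quadBound n t m)) : Prop :=
  ∃ c : CollapseInt Γ e Δ, S.card = 2 ∧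
    ∀ (f : {f : Γ.E // f ≠ e}) (b : Bool),
      (Γ.ep f.1 b = Sum.inr c.uu →
        ∀ h : Δ.cmp (c.φE f) (xor (c.g f.1) b) < 4, (⟨_, h⟩ : Fin 4) ∈ S) ∧
      (Γ.ep f.1 b = Sum.inr c.vv →
        ∀ h : Δ.cmp (c.φE f) (xor (c.g f.1) b) < 4, (⟨_, h⟩ : Fin 4) ∉ S)

/-- a Wilson-edge collapse in which the slot coming from the earlier external
vertex `i0` sits at position `0` (if `w`) resp. `1` (if `¬w`). -/
def CollapseWilT {n t : ℕ} {m : Fin n ⊕ Fin t} (w : Bool)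
    (Γ : Tri (n+1) t) (i0 : Fin (n+1)) (Δ : BDiag n t (quadBound n t m)) : Prop :=
  ∃ c : CollapseWil Γ i0 Δ, ∀ (f : Γ.E) (b : Bool), Γ.ep f b = Sum.inl i0 →
    Δ.cmp (c.φE f) (xor (c.g f) b) = (if w then 0 else 1)

/-- the possible splitting types of a 4-valent vertex. -/
def LiftTy := Finset (Fin 4) ⊕ (Bool ⊕ Unit)

/-- `CollPairT τ P Q` : the pair `P` collapses onto `Q` with splitting type `τ`. -/
def CollPairT (τ : LiftTy) (P : SPair) (Q : QuadS) : Prop :=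
  match τ with
  | .inl S =>
      ∃ h : P.1 = (Q.1.1, Q.1.2 + 1),
        (match castPair h P.2 with
         | ⟨Γ, .inl e⟩ => CollapseIntT S Γ e Q.2.2
         | ⟨_, .inr _⟩ => False)
  | .inr (.inl w) =>
      ∃ h : P.1 = (Q.1.1 + 1, Q.1.2),
        (match castPair h P.2 with
         | ⟨Γ, .inr i0⟩ => CollapseWilT w Γ i0 Q.2.2
         | ⟨_, .inl _⟩ => False)
  | .inr (.inr _) =>
      ∃ h : P.1 = (Q.1.1, Q.1.2 + 1),
        (match castPair h P.2 with
         | ⟨Γ, .inl e⟩ => Nonempty (CollapseMix Γ e Q.2.2)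
         | ⟨_, .inr _⟩ => False)

/-- `Q` has no self-loop (no non-Wilson edge with both ends at one vertex). -/
def noLoop (Q : QuadS) : Prop :=
  ∀ f : Q.2.2.E, Q.2.2.ep f false ≠ Q.2.2.ep f true

/-- `Q` has no double edge (no two distinct non-Wilson edges with the same pair
of endpoints). -/
def noDouble (Q : QuadS) : Prop :=
  ∀ f f' : Q.2.2.E,
    ((Q.2.2.ep f false = Q.2.2.ep f' false ∧ Q.2.2.ep f true = Q.2.2.ep f' true) ∨
     (Q.2.2.ep f false = Q.2.2.ep f' true ∧ Q.2.2.ep f true = Q.2.2.ep f' false)) → f = f'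

end
namespace WilsonLift

open Equiv

/-- The signature of a bijection between `Fin a` and `Fin b`, identified along `a = b`. -/
def finSign {a b : ℕ} (e : Fin a ≃ Fin b) : ℤˣ :=
  Perm.sign (e.trans (finCongr (by simpa using (Fintype.card_congr e).symm)))

theorem finSign_eq_sign {a : ℕ} (e : Perm (Fin a)) : finSign e = Perm.sign e := rfl

theorem finSign_eq_one {a b : ℕ} (ha : a = 1) (e : Fin a ≃ Fin b) : finSign e = 1 := by
  subst ha
  unfold finSign
  rw [Subsingleton.elim (e.trans _) (1 : Perm (Fin 1)), map_one]

theorem finSign_mul_sign {a b c : ℕ} (ha : c = a) (e : Fin a ≃ Fin b) (r r' : Perm (Fin c))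
    (h : ∀ i : Fin a, ∃ (h₁ : i.val < c) (h₂ : (e i).val < c),
      (r ⟨i.val, h₁⟩).val = (r' ⟨(e i).val, h₂⟩).val) :
    finSign e * Perm.sign r' = Perm.sign r := by
  subst ha
  obtain rfl : c = b := by simpa using Fintype.card_congr e
  have : r = r' * e := by
    ext i
    obtain ⟨h₁, h₂, h₃⟩ := h i
    exact h₃
  rw [this, finSign_eq_sign, map_mul, mul_comm]

theorem exists_perm_two_of_perm_three : ∀ (A : Perm (Fin 3)) (p : Fin 3),
    ∃ α : Perm (Fin 2), Perm.sign α = Perm.sign A ∧ ∀ i : Fin 2, ∃ s : Fin 3, s ≠ p ∧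
      (s.val + 3 - p.val) % 3 = i.val + 1 ∧ ((A s).val + 3 - (A p).val) % 3 = (α i).val + 1 := by
  decide +kernel

theorem sign_of_blocks : ∀ (α β : Perm (Fin 2)) (τ : Perm (Fin 4)),
    (∀ i : Fin 2, τ (Fin.castAdd 2 i) = Fin.castAdd 2 (α i)) →
    (∀ i : Fin 2, τ (Fin.natAdd 2 i) = Fin.natAdd 2 (β i)) →
    Perm.sign α * Perm.sign β = Perm.sign τ := by
  decide +kernel

theorem sign_of_swapped_blocks : ∀ (α β : Perm (Fin 2)) (τ : Perm (Fin 4)),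
    (∀ i : Fin 2, τ (Fin.castAdd 2 i) = Fin.natAdd 2 (α i)) →
    (∀ i : Fin 2, τ (Fin.natAdd 2 i) = Fin.castAdd 2 (β i)) →
    Perm.sign α * Perm.sign β = Perm.sign τ := by
  decide +kernel

/-- A reordering of three slots that moves the slot `p` to `p'` induces a permutation of the two
remaining slots, counted cyclically after `p` resp. `p'`, of the same signature. -/
theorem exists_perm_two {a b : ℕ} (ha : a = 3) (A : Fin a ≃ Fin b) (p : Fin a) (p' : ℕ)
    (hp : (A p).val = p') :
    ∃ α : Perm (Fin 2), Perm.sign α = finSign A ∧ ∀ i : Fin 2, ∃ s : Fin a, s ≠ p ∧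
      (s.val + 3 - p.val) % 3 = i.val + 1 ∧ ((A s).val + 3 - p') % 3 = (α i).val + 1 := by
  subst ha hp
  obtain rfl : 3 = b := by simpa using Fintype.card_congr A
  exact exists_perm_two_of_perm_three A p

/-- Extend a bijection between complements of points to the whole types. -/
theorem exists_equiv_extending {α β : Type*} {v : α} {w : β}
    (E : {a // a ≠ v} ≃ {b // b ≠ w}) :
    ∃ P : α ≃ β, P v = w ∧ ∀ a (h : a ≠ v), P a = E ⟨a, h⟩ := by
  classical
  refine ⟨(Equiv.optionSubtypeNe v).symm.trans
    ((Equiv.optionCongr E).trans (Equiv.optionSubtypeNe w)), by simp, fun a h => ?_⟩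
  simp [h]

/-- Two maps `Fin (t+1) → Fin t`, injective off `v` resp. `v'`, are intertwined off these points by
a permutation carrying `v` to `v'`. -/
theorem exists_perm_intertwining {t : ℕ} (μ μ' : Fin (t + 1) → Fin t) (v v' : Fin (t + 1))
    (h : ∀ a b, a ≠ v → b ≠ v → μ a = μ b → a = b)
    (h' : ∀ a b, a ≠ v' → b ≠ v' → μ' a = μ' b → a = b) :
    ∃ π : Perm (Fin (t + 1)), π v = v' ∧ ∀ a, a ≠ v → π a ≠ v' ∧ μ' (π a) = μ a := by
  have key : ∀ (ν : Fin (t + 1) → Fin t) (w : Fin (t + 1)),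
      (∀ a b, a ≠ w → b ≠ w → ν a = ν b → a = b) →
      Function.Bijective (fun a : {a // a ≠ w} => ν a) := by
    intro ν w hν
    rw [Fintype.bijective_iff_injective_and_card]
    exact ⟨fun a b hab => Subtype.ext (hν a b a.2 b.2 hab), by simp⟩
  obtain ⟨π, hπ, hπ'⟩ := exists_equiv_extending
    ((Equiv.ofBijective _ (key μ v h)).trans (Equiv.ofBijective _ (key μ' v' h')).symm)
  refine ⟨π, hπ, fun a ha => ?_⟩
  rw [hπ' a ha]
  refine ⟨((Equiv.ofBijective _ (key μ' v' h')).symm (μ a)).2, ?_⟩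
  exact (Equiv.ofBijective _ (key μ' v' h')).apply_symm_apply (μ a)

theorem fin_add_right_injective {n : ℕ} (k : Fin n) : Function.Injective (· + k) := by
  have : NeZero n := ⟨k.pos.ne'⟩
  exact add_left_injective k

theorem exists_fin_sub {n : ℕ} (k k' : Fin n) : ∃ d : Fin n, ∀ i, i + d + k' = i + k := by
  have : NeZero n := ⟨k.pos.ne'⟩
  exact ⟨k - k', fun i => by abel⟩

theorem triBound_vmap {n t : ℕ} (k : Fin n) (π : Perm (Fin t)) (v : Fin n ⊕ Fin t) :
    triBound n t (vmap k π v) = triBound n t v := by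
  cases v <;> rfl

/-- An isomorphism of the underlying trivalent Wilson graphs underlies a `BIso`. -/
theorem exists_bIso_of_uIso {n t : ℕ} {Γ Γ' : Tri n t} (u : UIso Γ Γ') :
    ∃ φ : BIso Γ Γ', φ.ψ = u.ψ ∧ φ.fl = u.fl ∧ φ.k = u.k ∧ φ.π = u.π := by
  let T : Γ.E × Bool → Γ'.E × Bool := fun h => (u.ψ h.1, xor (u.fl h.1) h.2)
  have hT : Function.Injective T := by
    rintro ⟨f, b⟩ ⟨f', b'⟩ h
    simp only [T, Prod.mk.injEq, EmbeddingLike.apply_eq_iff_eq] at h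
    obtain ⟨rfl, h⟩ := h
    simpa using h
  have hex : ∀ v (s : Fin (triBound n t v)), ∃ s' : Fin (triBound n t (vmap u.k u.π v)),
      Γ'.anch (T (Γ.anch.symm ⟨v, s⟩)) = ⟨vmap u.k u.π v, s'⟩ := by
    intro v s
    have h : (Γ'.anch (T (Γ.anch.symm ⟨v, s⟩))).1 = vmap u.k u.π v := by
      have := u.hep (Γ.anch.symm ⟨v, s⟩).1 (Γ.anch.symm ⟨v, s⟩).2
      simpa [BDiag.ep] using this
    revert h
    obtain ⟨w, s'⟩ := Γ'.anch (T (Γ.anch.symm ⟨v, s⟩))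
    rintro rfl
    exact ⟨s', rfl⟩
  choose r hr using hex
  have hinj : ∀ v, Function.Injective (r v) := by
    intro v s s' h
    have : Γ'.anch (T (Γ.anch.symm ⟨v, s⟩)) = Γ'.anch (T (Γ.anch.symm ⟨v, s'⟩)) := by
      rw [hr, hr, h]
    simpa using hT (Γ'.anch.injective this)
  have hbij : ∀ v, Function.Bijective (r v) := fun v =>
    (Fintype.bijective_iff_injective_and_card _).2 ⟨hinj v, by simp [triBound_vmap]⟩
  refine ⟨⟨u.ψ, u.fl, u.k, u.π, fun v => Equiv.ofBijective _ (hbij v), fun e b => ?_⟩,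
    rfl, rfl, rfl, rfl⟩
  simpa [T] using hr (Γ.anch (e, b)).1 (Γ.anch (e, b)).2

/-- The data common to the three kinds of collapse of an edge of `Γ` onto `Δ`: the endpoints `U`
and `W` are merged into the vertex `m` by the vertex map `M`, the surviving edges `N` are
identified with those of `Δ`, and slot `s` at `v` moves to position `J v s`, up to an even
reordering `ρ`. -/
structure Lift {n₁ t₁ n t : ℕ} {bd : Fin n ⊕ Fin t → ℕ} (m : Fin n ⊕ Fin t)
    (Γ : Tri n₁ t₁) (Δ : BDiag n t bd) where
  M : Fin n₁ ⊕ Fin t₁ → Fin n ⊕ Fin t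
  U : Fin n₁ ⊕ Fin t₁
  W : Fin n₁ ⊕ Fin t₁
  ne : U ≠ W
  map_U : M U = m
  map_W : M W = m
  inj : ∀ a b, M a = M b → M a ≠ m → a = b
  fiber : ∀ a, M a = m → a = U ∨ a = W
  surj : Function.Surjective M
  bound : ∀ v, M v ≠ m → bd (M v) = triBound n₁ t₁ v
  N : Γ.E → Prop
  ends : ∀ f, ¬ N f → ∀ b, Γ.ep f b = U ∨ Γ.ep f b = W
  φE : {f : Γ.E // N f} ≃ Δ.E
  g : Γ.E → Bool
  hep : ∀ (f : {f : Γ.E // N f}) (b : Bool), Δ.ep (φE f) (xor (g f.1) b) = M (Γ.ep f.1 b)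
  J : Fin n₁ ⊕ Fin t₁ → ℕ → ℕ
  J_eq : ∀ v s, M v ≠ m → J v s = s
  ρ : (v : Fin n ⊕ Fin t) → Perm (Fin (bd v))
  hsgn : ∏ v : Fin n ⊕ Fin t, Perm.sign (ρ v) = 1
  hcmp : ∀ (f : {f : Γ.E // N f}) (b : Bool),
    ∃ h : J (Γ.ep f.1 b) (Γ.cmp f.1 b) < bd (M (Γ.ep f.1 b)),
      Δ.cmp (φE f) (xor (g f.1) b) =
        (ρ (M (Γ.ep f.1 b)) ⟨J (Γ.ep f.1 b) (Γ.cmp f.1 b), h⟩ : Fin _).val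

namespace Lift

variable {n₁ t₁ n t : ℕ} {bd : Fin n ⊕ Fin t → ℕ} {m : Fin n ⊕ Fin t}
  {Γ Γ' : Tri n₁ t₁} {Δ : BDiag n t bd}

/-- `ψ`, `fl` match the surviving half-edges of two lifts through `Δ`. -/
def Compat (L : Lift m Γ Δ) (L' : Lift m Γ' Δ) (ψ : Γ.E ≃ Γ'.E) (fl : Γ.E → Bool) : Prop :=
  ∀ f (h : L.N f), ∃ h' : L'.N (ψ f),
    L'.φE ⟨ψ f, h'⟩ = L.φE ⟨f, h⟩ ∧ xor (L'.g (ψ f)) (fl f) = L.g f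

theorem Compat.ep_eq {L : Lift m Γ Δ} {L' : Lift m Γ' Δ} {ψ : Γ.E ≃ Γ'.E} {fl : Γ.E → Bool}
    (h : Compat L L' ψ fl) {f : Γ.E} (hf : L.N f) (b : Bool) :
    L'.M (Γ'.ep (ψ f) (xor (fl f) b)) = L.M (Γ.ep f b) := by
  obtain ⟨h', h₁, h₂⟩ := h f hf
  rw [← L.hep ⟨f, hf⟩ b, ← L'.hep ⟨ψ f, h'⟩, h₁, ← h₂, Bool.xor_assoc]

theorem Compat.cmp_eq {L : Lift m Γ Δ} {L' : Lift m Γ' Δ} {ψ : Γ.E ≃ Γ'.E} {fl : Γ.E → Bool}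
    (h : Compat L L' ψ fl) {f : Γ.E} (hf : L.N f) (b : Bool) {v v' : Fin n₁ ⊕ Fin t₁}
    (hv : Γ.ep f b = v) (hv' : Γ'.ep (ψ f) (xor (fl f) b) = v') {w : Fin n ⊕ Fin t}
    (hw : L.M v = w) :
    ∃ (h₁ : L.J v (Γ.cmp f b) < bd w) (h₂ : L'.J v' (Γ'.cmp (ψ f) (xor (fl f) b)) < bd w),
      (L.ρ w ⟨_, h₁⟩).val = (L'.ρ w ⟨_, h₂⟩).val := by
  have hw' : L'.M v' = w := by rw [← hv', h.ep_eq hf b, hv, hw]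
  obtain ⟨h', e₁, e₂⟩ := h f hf
  obtain ⟨a, ha⟩ := L.hcmp ⟨f, hf⟩ b
  obtain ⟨c, hc⟩ := L'.hcmp ⟨ψ f, h'⟩ (xor (fl f) b)
  rw [e₁, ← Bool.xor_assoc, e₂, ha] at hc
  clear ha
  subst hv hv' hw
  revert c
  generalize L'.M (Γ'.ep (ψ f) (xor (fl f) b)) = y at hw' ⊢
  subst hw'
  exact fun c hc => ⟨a, c, hc⟩

theorem exists_bIso (L : Lift m Γ Δ) (L' : Lift m Γ' Δ) (ψ : Γ.E ≃ Γ'.E) (fl : Γ.E → Bool)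
    (k : Fin n₁) (π : Perm (Fin t₁)) (hc : Compat L L' ψ fl)
    (hM : ∀ v, L'.M (vmap k π v) = L.M v)
    (hep : ∀ f b, Γ.ep f b = L.U ∨ Γ.ep f b = L.W →
      Γ'.ep (ψ f) (xor (fl f) b) = vmap k π (Γ.ep f b)) :
    ∃ φ : BIso Γ Γ', φ.ψ = ψ ∧ φ.fl = fl ∧ φ.k = k ∧ φ.π = π := by
  refine exists_bIso_of_uIso ⟨ψ, fl, k, π, fun f b => ?_⟩
  by_cases hf : L.N f
  · by_cases hm : L.M (Γ.ep f b) = m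
    · exact hep f b (L.fiber _ hm)
    · have h := hc.ep_eq hf b
      exact L'.inj _ _ (h.trans (hM _).symm) (h ▸ hm)
  · exact hep f b (L.ends f hf b)

theorem local_rel (L : Lift m Γ Δ) (L' : Lift m Γ' Δ) (φ : BIso Γ Γ')
    (hc : Compat L L' φ.ψ φ.fl) {v : Fin n₁ ⊕ Fin t₁} {w : Fin n ⊕ Fin t} (hw : L.M v = w)
    (s : Fin (triBound n₁ t₁ v)) (hN : L.N (Γ.anch.symm ⟨v, s⟩).1) :
    ∃ (h₁ : L.J v s < bd w) (h₂ : L'.J (vmap φ.k φ.π v) (φ.ρ v s) < bd w),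
      (L.ρ w ⟨_, h₁⟩).val = (L'.ρ w ⟨_, h₂⟩).val := by
  obtain ⟨⟨f, b⟩, hfb⟩ : ∃ x, x = Γ.anch.symm ⟨v, s⟩ := ⟨_, rfl⟩
  rw [← hfb] at hN
  have ha : Γ.anch (f, b) = ⟨v, s⟩ := by rw [hfb, Equiv.apply_symm_apply]
  have ha' := φ.hanch f b
  have hv : Γ.ep f b = v := by rw [BDiag.ep, ha]
  have hv' : Γ'.ep (φ.ψ f) (xor (φ.fl f) b) = vmap φ.k φ.π v := by rw [BDiag.ep, ha', ha]
  have hs : Γ.cmp f b = s := by rw [BDiag.cmp, ha]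
  have hs' : Γ'.cmp (φ.ψ f) (xor (φ.fl f) b) = φ.ρ v s := by rw [BDiag.cmp, ha', ha]
  have := hc.cmp_eq hN b hv hv' hw
  simp only [hs, hs'] at this
  exact this

theorem sign_eq_one (L : Lift m Γ Δ) (L' : Lift m Γ' Δ) (φ : BIso Γ Γ')
    (hc : Compat L L' φ.ψ φ.fl) (hM : ∀ v, L'.M (vmap φ.k φ.π v) = L.M v)
    (hloc : finSign (φ.ρ L.U) * finSign (φ.ρ L.W) * Perm.sign (L'.ρ m) = Perm.sign (L.ρ m)) :
    φ.sign = 1 := by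
  have hfib : ∀ w, ∏ v with L.M v = w, finSign (φ.ρ v) =
      Perm.sign (L.ρ w) * Perm.sign (L'.ρ w) := by
    intro w
    rw [eq_comm, ← mul_right_inj (Perm.sign (L'.ρ w)), mul_comm, mul_assoc, Int.units_mul_self,
      mul_one, eq_comm, mul_comm]
    by_cases hw : w = m
    · subst hw
      have : (Finset.univ.filter fun v => L.M v = w) = {L.U, L.W} := by
        ext v
        simp only [Finset.mem_filter, Finset.mem_univ, true_and, Finset.mem_insert,
          Finset.mem_singleton]
        exact ⟨L.fiber v, by rintro (rfl | rfl); exacts [L.map_U, L.map_W]⟩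
      rw [this, Finset.prod_pair L.ne, hloc]
    · obtain ⟨v, rfl⟩ := L.surj w
      have : (Finset.univ.filter fun u => L.M u = L.M v) = {v} := by
        ext u
        simp only [Finset.mem_filter, Finset.mem_univ, true_and, Finset.mem_singleton]
        exact ⟨fun h => L.inj _ _ h (h ▸ hw), fun h => h ▸ rfl⟩
      rw [this, Finset.prod_singleton]
      refine finSign_mul_sign (L.bound v hw) _ _ _ fun s => ?_
      have hN : L.N (Γ.anch.symm ⟨v, s⟩).1 := by
        by_contra hN
        have h := L.ends _ hN (Γ.anch.symm ⟨v, s⟩).2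
        simp only [BDiag.ep, Prod.mk.eta, Equiv.apply_symm_apply] at h
        rcases h with rfl | rfl
        exacts [hw L.map_U, hw L.map_W]
      have := L.local_rel L' φ hc rfl s hN
      simpa only [L.J_eq _ _ hw, L'.J_eq _ _ (by rwa [hM])] using this
  calc φ.sign = ∏ v, finSign (φ.ρ v) := rfl
    _ = ∏ w, ∏ v with L.M v = w, finSign (φ.ρ v) := (Finset.prod_fiberwise _ _ _).symm
    _ = 1 := by simp only [hfib, Finset.prod_mul_distrib, L.hsgn, L'.hsgn, mul_one]

end Lift

theorem triBound_inl {n t : ℕ} (i : Fin n) : triBound n t (Sum.inl i) = 1 := rfl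

theorem triBound_inr {n t : ℕ} (w : Fin t) : triBound n t (Sum.inr w) = 3 := rfl

theorem quadBound_of_ne {n t : ℕ} {m v : Fin n ⊕ Fin t} (h : v ≠ m) :
    quadBound n t m v = triBound n t v := if_neg h

theorem quadBound_self_inr {n t : ℕ} {m : Fin n ⊕ Fin t} {x : Fin t} (hm : m = Sum.inr x) :
    quadBound n t m m = 4 := by
  subst hm; simp [quadBound]

theorem quadBound_self_inl {n t : ℕ} {m : Fin n ⊕ Fin t} {x : Fin n} (hm : m = Sum.inl x) :
    quadBound n t m m = 2 := by
  subst hm; simp [quadBound]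

theorem ep_eq_of_anch {n t : ℕ} {bd : Fin n ⊕ Fin t → ℕ} {Γ : BDiag n t bd} {e : Γ.E} {b : Bool}
    {v : Fin n ⊕ Fin t} {s : Fin (bd v)} (h : Γ.anch (e, b) = ⟨v, s⟩) : Γ.ep e b = v := by
  rw [BDiag.ep, h]

theorem cmp_eq_of_anch {n t : ℕ} {bd : Fin n ⊕ Fin t → ℕ} {Γ : BDiag n t bd} {e : Γ.E} {b : Bool}
    {v : Fin n ⊕ Fin t} {s : Fin (bd v)} (h : Γ.anch (e, b) = ⟨v, s⟩) : Γ.cmp e b = s := by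
  rw [BDiag.cmp, h]

theorem exists_slot {n t : ℕ} {bd : Fin n ⊕ Fin t → ℕ} {Γ : BDiag n t bd} {e : Γ.E} {b : Bool}
    {v : Fin n ⊕ Fin t} (h : Γ.ep e b = v) : ∃ s, Γ.anch (e, b) = ⟨v, s⟩ := by
  subst h; exact ⟨_, rfl⟩

theorem ρ_slot {n t : ℕ} {bd bd' : Fin n ⊕ Fin t → ℕ} {Γ : BDiag n t bd} {Γ' : BDiag n t bd'}
    (φ : BIso Γ Γ') {e : Γ.E} {b : Bool} {v : Fin n ⊕ Fin t} {s : Fin (bd v)}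
    (h : Γ.anch (e, b) = ⟨v, s⟩) : (φ.ρ v s).val = Γ'.cmp (φ.ψ e) (xor (φ.fl e) b) := by
  rw [BDiag.cmp, φ.hanch, h]

/-- Two half-edges of a trivalent graph at the same internal vertex occupy different slots. -/
theorem one_le_cyclic_dist {n t : ℕ} {Γ : Tri n t} {f e : Γ.E} {b b' : Bool} {w : Fin t}
    (hf : Γ.ep f b = Sum.inr w) (he : Γ.ep e b' = Sum.inr w) (hne : f ≠ e) :
    1 ≤ (Γ.cmp f b + 3 - Γ.cmp e b') % 3 := by
  obtain ⟨s, hs⟩ := exists_slot hf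
  obtain ⟨p, hp⟩ := exists_slot he
  rw [cmp_eq_of_anch hs, cmp_eq_of_anch hp]
  have hs3 : s.val < 3 := s.2
  have hp3 : p.val < 3 := p.2
  have : s.val ≠ p.val := by
    intro h
    rw [Fin.ext h, ← hp] at hs
    exact hne (congrArg Prod.fst (Γ.anch.injective hs))
  omega

theorem edge_ne_of_slot_ne {n t : ℕ} {Γ : Tri n t} {e : Γ.E} {b : Bool} {v : Fin n ⊕ Fin t}
    {s p : Fin (triBound n t v)} (hp : Γ.anch (e, b) = ⟨v, p⟩) (hsp : s ≠ p)
    (hv : Γ.ep e (!b) ≠ v) : (Γ.anch.symm ⟨v, s⟩).1 ≠ e := by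
  intro h
  have hs : Γ.anch (e, (Γ.anch.symm ⟨v, s⟩).2) = ⟨v, s⟩ := by
    rw [← h, Prod.mk.eta, Equiv.apply_symm_apply]
  generalize (Γ.anch.symm ⟨v, s⟩).2 = b' at hs
  by_cases hb : b' = b
  · rw [hb, hp] at hs
    exact hsp (by simpa using hs.symm)
  · rw [show b' = !b by cases b <;> cases b' <;> simp_all] at hs
    exact hv (ep_eq_of_anch hs)

theorem exists_edge_equiv {A B D : Type*} {e : A} {e' : B} (F : {f // f ≠ e} ≃ D)
    (F' : {f // f ≠ e'} ≃ D) :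
    ∃ ψ : A ≃ B, ψ e = e' ∧ ∀ f (h : f ≠ e), ∃ h' : ψ f ≠ e', F' ⟨ψ f, h'⟩ = F ⟨f, h⟩ := by
  obtain ⟨ψ, h₁, h₂⟩ := exists_equiv_extending (F.trans F'.symm)
  refine ⟨ψ, h₁, fun f h => ?_⟩
  have hf : ψ f = F'.symm (F ⟨f, h⟩) := h₂ f h
  have h' : ψ f ≠ e' := hf ▸ (F'.symm (F ⟨f, h⟩)).2
  refine ⟨h', ?_⟩
  rw [show (⟨ψ f, h'⟩ : {f // f ≠ e'}) = F'.symm (F ⟨f, h⟩) from Subtype.ext hf,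
    Equiv.apply_symm_apply]

theorem sign_blocks {c : ℕ} (hc : c = 4) (sw : Bool) (r r' : Perm (Fin c)) (α β : Perm (Fin 2))
    (hα : ∀ i : Fin 2, ∃ (h₁ : i.val < c) (h₂ : (α i).val + (if sw then 2 else 0) < c),
      (r ⟨_, h₁⟩).val = (r' ⟨_, h₂⟩).val)
    (hβ : ∀ i : Fin 2, ∃ (h₁ : i.val + 2 < c) (h₂ : (β i).val + (if sw then 0 else 2) < c),
      (r ⟨_, h₁⟩).val = (r' ⟨_, h₂⟩).val) :
    Perm.sign α * Perm.sign β * Perm.sign r' = Perm.sign r := by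
  subst hc
  have h : r = r' * (r'⁻¹ * r) := by group
  rw [h, map_mul _ r', mul_comm]
  congr 1
  cases sw
  · refine sign_of_blocks α β _ (fun i => ?_) fun i => ?_ <;>
      rw [Perm.mul_apply, Perm.inv_eq_iff_eq]
    · obtain ⟨h₁, h₂, h₃⟩ := hα i
      exact Fin.ext h₃
    · obtain ⟨h₁, h₂, h₃⟩ := hβ i
      convert Fin.ext h₃ using 2 <;> exact Fin.ext (by simp [add_comm])
  · refine sign_of_swapped_blocks α β _ (fun i => ?_) fun i => ?_ <;>
      rw [Perm.mul_apply, Perm.inv_eq_iff_eq]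
    · obtain ⟨h₁, h₂, h₃⟩ := hα i
      convert Fin.ext h₃ using 2 <;> exact Fin.ext (by simp [add_comm])
    · obtain ⟨h₁, h₂, h₃⟩ := hβ i
      convert Fin.ext h₃ using 2 <;> exact Fin.ext (by simp [add_comm])

/-- The partition of `Fin 4` into the images of `{0, 1}` and `{2, 3}` under a permutation. -/
def pairing (r : Perm (Fin 4)) : Fin 3 :=
  if decide (2 ≤ (r.symm 0).val) = decide (2 ≤ (r.symm 1).val) then 0
  else if decide (2 ≤ (r.symm 0).val) = decide (2 ≤ (r.symm 2).val) then 1 else 2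

theorem exists_side_of_pairing_eq : ∀ r r' : Perm (Fin 4), pairing r = pairing r' →
    ∃ sw : Bool, ∀ y : Fin 4,
      decide (2 ≤ (r.symm y).val) = xor sw (decide (2 ≤ (r'.symm y).val)) := by
  decide +kernel

theorem exists_pairing {c : ℕ} (hc : c = 4) : ∃ ty : Perm (Fin c) → Fin 3,
    ∀ r r', ty r = ty r' → ∃ sw : Bool, ∀ i j : Fin c, (r i).val = (r' j).val →
      decide (2 ≤ i.val) = xor sw (decide (2 ≤ j.val)) := by
  subst hc
  refine ⟨pairing, fun r r' h => ?_⟩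
  obtain ⟨sw, hsw⟩ := exists_side_of_pairing_eq r r' h
  refine ⟨sw, fun i j hij => ?_⟩
  have h₁ := hsw (r i)
  rwa [symm_apply_apply, Fin.ext hij, symm_apply_apply] at h₁

section Int

variable {n t : ℕ} {m : Fin n ⊕ Fin t} {Δ : BDiag n t (quadBound n t m)}

/-- The lift underlying the collapse of an internal edge. -/
def Lift.ofInt {Γ : Tri n (t + 1)} {e : Γ.E} (c : CollapseInt Γ e Δ) : Lift m Γ Δ where
  M := Sum.map (· + c.k) c.μ
  U := Sum.inr c.uu
  W := Sum.inr c.vv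
  ne := fun h => c.hne (Sum.inr_injective h)
  map_U := by simp [c.hμu, c.hm]
  map_W := by simp [c.hμv, c.hm]
  inj := by
    have hm := c.hm
    rintro (a | a) (b | b) hab ha <;> simp only [Sum.map_inl, Sum.map_inr, reduceCtorEq] at hab ha
    · exact congrArg _ (fin_add_right_injective c.k (Sum.inl_injective hab))
    · have hab := Sum.inr_injective hab
      refine congrArg _ (c.hinj a b ?_ ?_ hab) <;> rintro rfl
      · exact ha (by rw [c.hμv]; exact hm.symm)
      · exact ha (by rw [hab, c.hμv]; exact hm.symm)
  fiber := by
    rintro (a | a) h <;> simp only [Sum.map_inl, Sum.map_inr, c.hm, reduceCtorEq] at h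
    by_cases ha : a = c.vv
    · exact Or.inr (congrArg _ ha)
    · exact Or.inl (congrArg _ (c.hinj a c.uu ha c.hne (by rw [c.hμu]; exact Sum.inr_injective h)))
  surj := Sum.map_surjective.2
    ⟨Finite.surjective_of_injective (fin_add_right_injective c.k), c.hsurj⟩
  bound := by
    rintro v hv
    rw [quadBound_of_ne hv]
    cases v <;> rfl
  N f := f ≠ e
  ends := by
    intro f hf b
    obtain rfl := not_not.1 hf
    cases b
    exacts [Or.inl c.hu, Or.inr c.hv]
  φE := c.φE
  g := c.g
  hep := c.hep
  J v s := if v = Sum.inr c.uu then (s + 3 - Γ.cmp e false) % 3 - 1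
    else if v = Sum.inr c.vv then (s + 3 - Γ.cmp e true) % 3 + 1 else s
  J_eq := by
    intro v s hv
    rw [if_neg, if_neg]
    · rintro rfl; exact hv (by simp [c.hμv, c.hm])
    · rintro rfl; exact hv (by simp [c.hμu, c.hm])
  ρ := c.ρ
  hsgn := c.hsgn
  hcmp := c.hcmp

theorem Lift.ofInt_J_uu {Γ : Tri n (t + 1)} {e : Γ.E} (c : CollapseInt Γ e Δ) (s : ℕ) :
    (Lift.ofInt c).J (Sum.inr c.uu) s = (s + 3 - Γ.cmp e false) % 3 - 1 := if_pos rfl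

theorem Lift.ofInt_J_vv {Γ : Tri n (t + 1)} {e : Γ.E} (c : CollapseInt Γ e Δ) (s : ℕ) :
    (Lift.ofInt c).J (Sum.inr c.vv) s = (s + 3 - Γ.cmp e true) % 3 + 1 :=
  (if_neg fun h => c.hne (Sum.inr_injective h).symm).trans (if_pos rfl)

/-- Collapses of internal edges onto `Δ` that split the four slots at the 4-valent vertex into the
same two pairs are equivalent. -/
theorem exists_bIso_of_collapseInt {Γ Γ' : Tri n (t + 1)} {e : Γ.E} {e' : Γ'.E}
    (c : CollapseInt Γ e Δ) (c' : CollapseInt Γ' e' Δ) (sw : Bool)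
    (hsw : ∀ i j, (c.ρ m i).val = (c'.ρ m j).val →
      decide (2 ≤ i.val) = xor sw (decide (2 ≤ j.val))) :
    ∃ φ : BIso Γ Γ', φ.sign = 1 ∧ φ.ψ e = e' := by
  have hc4 := quadBound_self_inr c.hm
  obtain ⟨d, hd⟩ := exists_fin_sub c.k c'.k
  have hx : c'.x = c.x := Sum.inr_injective (c'.hm.symm.trans c.hm)
  -- the images of the two endpoints of `e`
  obtain ⟨u', hu'⟩ : ∃ u', u' = if sw then c'.vv else c'.uu := ⟨_, rfl⟩
  obtain ⟨v', hv'⟩ : ∃ v', v' = if sw then c'.uu else c'.vv := ⟨_, rfl⟩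
  have hfib : ∀ a, c'.μ a = c.x → a ≠ v' → a = u' := by
    intro a ha hav
    have := (Lift.ofInt c').fiber (Sum.inr a) (by simp [Lift.ofInt, ha, c.hm])
    cases sw <;> simp_all [Lift.ofInt]
  have hμu' : c'.μ u' = c.x := by subst hu'; split_ifs; exacts [c'.hμv.trans hx, c'.hμu.trans hx]
  have hμv' : c'.μ v' = c.x := by subst hv'; split_ifs; exacts [c'.hμu.trans hx, c'.hμv.trans hx]
  have hinj' : ∀ a b, a ≠ v' → b ≠ v' → c'.μ a = c'.μ b → a = b := by
    intro a b ha hb hab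
    by_cases h : c'.μ a = c.x
    · rw [hfib a h ha, hfib b (hab ▸ h) hb]
    · refine c'.hinj a b ?_ ?_ hab <;> rintro rfl
      · exact h (c'.hμv.trans hx)
      · exact h (hab.trans (c'.hμv.trans hx))
  obtain ⟨π, hπv, hπ⟩ := exists_perm_intertwining c.μ c'.μ c.vv v' c.hinj hinj'
  have hπu : π c.uu = u' :=
    hfib _ ((hπ c.uu c.hne).2.trans c.hμu) (hπ c.uu c.hne).1
  obtain ⟨ψ, hψe, hψ⟩ := exists_edge_equiv c.φE c'.φE
  obtain ⟨fl, hfl⟩ : ∃ fl : Γ.E → Bool,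
      fl = fun f => if f = e then sw else xor (c'.g (ψ f)) (c.g f) := ⟨_, rfl⟩
  have hfle : fl e = sw := by simp [hfl]
  have hcompat : Lift.Compat (Lift.ofInt c) (Lift.ofInt c') ψ fl := by
    intro f hf
    obtain ⟨h', h⟩ := hψ f hf
    refine ⟨h', h, ?_⟩
    rw [hfl]
    simp only [if_neg (show f ≠ e from hf)]
    change xor (c'.g (ψ f)) (xor (c'.g (ψ f)) (c.g f)) = c.g f
    rw [← Bool.xor_assoc, Bool.xor_self, Bool.false_xor]
  have hM : ∀ v, (Lift.ofInt c').M (vmap d π v) = (Lift.ofInt c).M v := by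
    rintro (i | a)
    · exact congrArg Sum.inl (hd i)
    · refine congrArg Sum.inr ?_
      by_cases ha : a = c.vv
      · rw [ha, hπv, hμv', c.hμv]
      · exact (hπ a ha).2
  have hepe : ∀ b, Γ'.ep e' (xor sw b) = vmap d π (Γ.ep e b) := by
    intro b
    cases b
    · rw [c.hu]
      simp only [vmap, Sum.map_inr, hπu, hu']
      cases sw
      exacts [c'.hu, c'.hv]
    · rw [c.hv]
      simp only [vmap, Sum.map_inr, hπv, hv']
      cases sw
      exacts [c'.hv, c'.hu]
  have hep : ∀ f b, Γ.ep f b = Sum.inr c.uu ∨ Γ.ep f b = Sum.inr c.vv →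
      Γ'.ep (ψ f) (xor (fl f) b) = vmap d π (Γ.ep f b) := by
    intro f b hfb
    by_cases hf : f = e
    · rw [hf, hψe, hfle, hepe]
    have hf' : ψ f ≠ e' := fun h => hf (ψ.injective (h.trans hψe.symm))
    have hw : (Lift.ofInt c).M (Γ.ep f b) = m := by
      rcases hfb with h | h <;> rw [h]
      exacts [(Lift.ofInt c).map_U, (Lift.ofInt c).map_W]
    have hfb' := (Lift.ofInt c').fiber _ ((hcompat.ep_eq hf b).trans hw)
    obtain ⟨h₁, h₂, h⟩ := hcompat.cmp_eq (f := f) hf b rfl rfl hw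
    have h := hsw _ _ h
    simp only at h
    have key : ∀ {Γ₀ : Tri n (t + 1)} {e₀ : Γ₀.E} (c₀ : CollapseInt Γ₀ e₀ Δ) {f₀ : Γ₀.E}
        {b₀ : Bool}, f₀ ≠ e₀ →
        (Γ₀.ep f₀ b₀ = Sum.inr c₀.uu →
          decide (2 ≤ (Lift.ofInt c₀).J (Γ₀.ep f₀ b₀) (Γ₀.cmp f₀ b₀)) = false) ∧
        (Γ₀.ep f₀ b₀ = Sum.inr c₀.vv →
          decide (2 ≤ (Lift.ofInt c₀).J (Γ₀.ep f₀ b₀) (Γ₀.cmp f₀ b₀)) = true) := by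
      intro Γ₀ e₀ c₀ f₀ b₀ hne
      refine ⟨fun h => ?_, fun h => ?_⟩
      · rw [h, Lift.ofInt_J_uu, decide_eq_false_iff_not]
        omega
      · rw [h, Lift.ofInt_J_vv, decide_eq_true_iff]
        have := one_le_cyclic_dist h c₀.hv hne
        omega
    rcases hfb with h₀ | h₀ <;> rcases hfb' with h₀' | h₀'
    · rw [(key c hf).1 h₀, (key c' hf').1 h₀'] at h
      have hs : sw = false := by revert h; cases sw <;> simp
      rw [h₀', h₀]
      change Sum.inr _ = Sum.inr (π c.uu)
      rw [hπu, hu', hs]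
      rfl
    · rw [(key c hf).1 h₀, (key c' hf').2 h₀'] at h
      have hs : sw = true := by revert h; cases sw <;> simp
      rw [h₀', h₀]
      change Sum.inr _ = Sum.inr (π c.uu)
      rw [hπu, hu', hs]
      rfl
    · rw [(key c hf).2 h₀, (key c' hf').1 h₀'] at h
      have hs : sw = true := by revert h; cases sw <;> simp
      rw [h₀', h₀]
      change Sum.inr _ = Sum.inr (π c.vv)
      rw [hπv, hv', hs]
      rfl
    · rw [(key c hf).2 h₀, (key c' hf').2 h₀'] at h
      have hs : sw = false := by revert h; cases sw <;> simp
      rw [h₀', h₀]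
      change Sum.inr _ = Sum.inr (π c.vv)
      rw [hπv, hv', hs]
      rfl
  obtain ⟨φ, rfl, rfl, rfl, rfl⟩ :=
    (Lift.ofInt c).exists_bIso (Lift.ofInt c') ψ fl d π hcompat hM hep
  refine ⟨φ, (Lift.ofInt c).sign_eq_one (Lift.ofInt c') φ hcompat hM ?_, hψe⟩
  obtain ⟨p, hp⟩ := exists_slot c.hu
  obtain ⟨q, hq⟩ := exists_slot c.hv
  obtain ⟨α, hα, hα'⟩ := exists_perm_two (triBound_inr c.uu) (φ.ρ _) p _ (ρ_slot φ hp)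
  obtain ⟨β, hβ, hβ'⟩ := exists_perm_two (triBound_inr c.vv) (φ.ρ _) q _ (ρ_slot φ hq)
  rw [hfle, hψe] at hα' hβ'
  change finSign (φ.ρ (Sum.inr c.uu)) * finSign (φ.ρ (Sum.inr c.vv)) * _ = _
  rw [← hα, ← hβ]
  refine sign_blocks hc4 sw _ _ _ _ (fun i => ?_) fun i => ?_
  · obtain ⟨s, hsp, h₁, h₂⟩ := hα' i
    have h := (Lift.ofInt c).local_rel (Lift.ofInt c') φ hcompat (Lift.ofInt c).map_U s
      (edge_ne_of_slot_ne hp hsp (by rw [Bool.not_false, c.hv]; exact (Lift.ofInt c).ne.symm))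
    have e₁ : (Lift.ofInt c).J (Lift.ofInt c).U s = i := by
      change (Lift.ofInt c).J (Sum.inr c.uu) s = i
      rw [Lift.ofInt_J_uu, cmp_eq_of_anch hp]; omega
    have e₂ : (Lift.ofInt c').J (vmap φ.k φ.π (Lift.ofInt c).U) (φ.ρ (Lift.ofInt c).U s) =
        (α i).val + (if sw then 2 else 0) := by
      change (Lift.ofInt c').J (Sum.inr (φ.π c.uu)) (φ.ρ (Sum.inr c.uu) s) = _
      rw [hπu, hu']
      cases sw
      · simp only [Bool.false_eq_true, if_false, Lift.ofInt_J_uu, Bool.false_xor] at h₂ ⊢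
        omega
      · simp only [if_true, Lift.ofInt_J_vv, Bool.true_xor, Bool.not_false] at h₂ ⊢
        omega
    simp only [e₁, e₂] at h
    exact h
  · obtain ⟨s, hsp, h₁, h₂⟩ := hβ' i
    have h := (Lift.ofInt c).local_rel (Lift.ofInt c') φ hcompat (Lift.ofInt c).map_W s
      (edge_ne_of_slot_ne hq hsp (by rw [Bool.not_true, c.hu]; exact (Lift.ofInt c).ne))
    have e₁ : (Lift.ofInt c).J (Lift.ofInt c).W s = i.val + 2 := by
      change (Lift.ofInt c).J (Sum.inr c.vv) s = _
      rw [Lift.ofInt_J_vv, cmp_eq_of_anch hq]; omega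
    have e₂ : (Lift.ofInt c').J (vmap φ.k φ.π (Lift.ofInt c).W) (φ.ρ (Lift.ofInt c).W s) =
        (β i).val + (if sw then 0 else 2) := by
      change (Lift.ofInt c').J (Sum.inr (φ.π c.vv)) (φ.ρ (Sum.inr c.vv) s) = _
      rw [hπv, hv']
      cases sw
      · simp only [Bool.false_eq_true, if_false, Lift.ofInt_J_vv, Bool.false_xor] at h₂ ⊢
        omega
      · simp only [if_true, Lift.ofInt_J_uu, Bool.true_xor, Bool.not_true] at h₂ ⊢
        omega
    simp only [e₁, e₂] at h
    exact h

end Int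

theorem edge_eq_of_ep_inl {n t : ℕ} {Γ : Tri n t} {f e : Γ.E} {b b' : Bool} {i : Fin n}
    (hf : Γ.ep f b = Sum.inl i) (he : Γ.ep e b' = Sum.inl i) : f = e := by
  obtain ⟨s, hs⟩ := exists_slot hf
  obtain ⟨p, hp⟩ := exists_slot he
  have : s = p := Subsingleton.elim (α := Fin 1) s p
  rw [this, ← hp] at hs
  exact congrArg Prod.fst (Γ.anch.injective hs)

section Mix

variable {n t : ℕ} {m : Fin n ⊕ Fin t} {Δ : BDiag n t (quadBound n t m)}

theorem vmapMix_inr_self (k : Fin n) (μ : Fin (t + 1) → Fin t) (v : Fin (t + 1)) (x : Fin n) :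
    vmapMix k μ v x (Sum.inr v) = Sum.inl x := if_pos rfl

theorem vmapMix_inr_of_ne (k : Fin n) (μ : Fin (t + 1) → Fin t) {v a : Fin (t + 1)} (x : Fin n)
    (h : a ≠ v) : vmapMix k μ v x (Sum.inr a) = Sum.inr (μ a) :=
  if_neg fun h' => h (Sum.inr_injective h')

theorem vmapMix_inl (k : Fin n) (μ : Fin (t + 1) → Fin t) (v : Fin (t + 1)) (x i : Fin n) :
    vmapMix k μ v x (Sum.inl i) = Sum.inl (i + k) := if_neg Sum.inl_ne_inr

/-- The lift underlying the collapse of an edge with one external endpoint. -/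
def Lift.ofMix {Γ : Tri n (t + 1)} {e : Γ.E} (c : CollapseMix Γ e Δ) : Lift m Γ Δ where
  M := vmapMix c.k c.μ c.vv c.x
  U := Sum.inl c.iu
  W := Sum.inr c.vv
  ne := Sum.inl_ne_inr
  map_U := by rw [vmapMix_inl, c.hx]; exact c.hm.symm
  map_W := by rw [vmapMix_inr_self]; exact c.hm.symm
  inj := by
    have hm := c.hm
    intro a b hab ha
    have ha' : a ≠ Sum.inr c.vv := by
      rintro rfl; exact ha (by rw [vmapMix_inr_self]; exact hm.symm)
    have hb' : b ≠ Sum.inr c.vv := by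
      rintro rfl; exact ha (by rw [hab, vmapMix_inr_self]; exact hm.symm)
    rw [vmapMix, vmapMix, if_neg ha', if_neg hb'] at hab
    rcases a with a | a <;> rcases b with b | b <;>
      simp only [Sum.map_inl, Sum.map_inr, reduceCtorEq] at hab
    · exact congrArg _ (fin_add_right_injective c.k (Sum.inl_injective hab))
    · exact congrArg _ (c.hinj a b (fun h => ha' (congrArg _ h)) (fun h => hb' (congrArg _ h))
        (Sum.inr_injective hab))
  fiber := by
    rintro (a | a) h
    · rw [vmapMix_inl] at h
      exact Or.inl (congrArg _ (fin_add_right_injective c.k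
        ((Sum.inl_injective (h.trans c.hm)).trans c.hx.symm)))
    · by_cases ha : a = c.vv
      · exact Or.inr (congrArg _ ha)
      · rw [vmapMix_inr_of_ne _ _ _ ha] at h
        exact absurd (h.trans c.hm) Sum.inr_ne_inl
  surj := by
    rintro (i | y)
    · obtain ⟨j, hj⟩ := Finite.surjective_of_injective (fin_add_right_injective c.k) i
      exact ⟨Sum.inl j, by rw [vmapMix_inl]; exact congrArg _ hj⟩
    · have hbij : Function.Bijective (fun a : {a // a ≠ c.vv} => c.μ a) :=
        (Fintype.bijective_iff_injective_and_card _).2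
          ⟨fun a b hab => Subtype.ext (c.hinj a b a.2 b.2 hab), by simp⟩
      obtain ⟨⟨a, ha⟩, rfl⟩ := hbij.2 y
      exact ⟨Sum.inr a, vmapMix_inr_of_ne _ _ _ ha⟩
  bound := by
    intro v hv
    rw [quadBound_of_ne hv]
    rcases v with i | a
    · rw [vmapMix_inl]; rfl
    · rw [vmapMix_inr_of_ne]
      · rfl
      · rintro rfl
        exact hv (by rw [vmapMix_inr_self]; exact c.hm.symm)
  N f := f ≠ e
  ends := by
    intro f hf b
    obtain rfl := not_not.1 hf
    by_cases hb : b = c.be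
    · exact Or.inl (hb ▸ c.hu)
    · exact Or.inr (by rw [Bool.eq_not.2 hb]; exact c.hv)
  φE := c.φE
  g := c.g
  hep := c.hep
  J v s := if v = Sum.inr c.vv then (s + 3 - Γ.cmp e (!c.be)) % 3 - 1 else s
  J_eq := by
    intro v s hv
    rw [if_neg]
    rintro rfl
    exact hv (by rw [vmapMix_inr_self]; exact c.hm.symm)
  ρ := c.ρ
  hsgn := c.hsgn
  hcmp := c.hcmp

/-- All collapses onto `Δ` of edges with one external endpoint are equivalent. -/
theorem exists_bIso_of_collapseMix {Γ Γ' : Tri n (t + 1)} {e : Γ.E} {e' : Γ'.E}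
    (c : CollapseMix Γ e Δ) (c' : CollapseMix Γ' e' Δ) :
    ∃ φ : BIso Γ Γ', φ.sign = 1 ∧ φ.ψ e = e' := by
  have hc2 := quadBound_self_inl c.hm
  obtain ⟨d, hd⟩ := exists_fin_sub c.k c'.k
  have hx : c'.x = c.x := Sum.inl_injective (c'.hm.symm.trans c.hm)
  have hiu : c.iu + d = c'.iu :=
    fin_add_right_injective c'.k ((hd c.iu).trans (c.hx.trans (hx.symm.trans c'.hx.symm)))
  obtain ⟨π, hπv, hπ⟩ := exists_perm_intertwining c.μ c'.μ c.vv c'.vv c.hinj c'.hinj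
  obtain ⟨ψ, hψe, hψ⟩ := exists_edge_equiv c.φE c'.φE
  obtain ⟨fl, hfl⟩ : ∃ fl : Γ.E → Bool,
      fl = fun f => if f = e then xor c'.be c.be else xor (c'.g (ψ f)) (c.g f) := ⟨_, rfl⟩
  have hfle : ∀ b, xor (fl e) (xor c.be b) = xor c'.be b := by
    intro b
    simp only [hfl, if_true]
    cases c.be <;> cases c'.be <;> cases b <;> rfl
  have hcompat : Lift.Compat (Lift.ofMix c) (Lift.ofMix c') ψ fl := by
    intro f hf
    obtain ⟨h', h⟩ := hψ f hf
    refine ⟨h', h, ?_⟩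
    rw [hfl]
    simp only [if_neg (show f ≠ e from hf)]
    change xor (c'.g (ψ f)) (xor (c'.g (ψ f)) (c.g f)) = c.g f
    rw [← Bool.xor_assoc, Bool.xor_self, Bool.false_xor]
  have hM : ∀ v, (Lift.ofMix c').M (vmap d π v) = (Lift.ofMix c).M v := by
    rintro (i | a)
    · change vmapMix c'.k c'.μ c'.vv c'.x (Sum.inl (i + d)) =
        vmapMix c.k c.μ c.vv c.x (Sum.inl i)
      rw [vmapMix_inl, vmapMix_inl, hd]
    · change vmapMix c'.k c'.μ c'.vv c'.x (Sum.inr (π a)) =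
        vmapMix c.k c.μ c.vv c.x (Sum.inr a)
      by_cases ha : a = c.vv
      · rw [ha, hπv, vmapMix_inr_self, vmapMix_inr_self, hx]
      · rw [vmapMix_inr_of_ne _ _ _ ha, vmapMix_inr_of_ne _ _ _ (hπ a ha).1, (hπ a ha).2]
  have hep : ∀ f b, Γ.ep f b = Sum.inl c.iu ∨ Γ.ep f b = Sum.inr c.vv →
      Γ'.ep (ψ f) (xor (fl f) b) = vmap d π (Γ.ep f b) := by
    intro f b hfb
    by_cases hf : f = e
    · subst hf
      obtain ⟨b, rfl⟩ : ∃ b', b = xor c.be b' :=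
        ⟨xor c.be b, by rw [← Bool.xor_assoc, Bool.xor_self, Bool.false_xor]⟩
      rw [hψe, hfle]
      cases b
      · rw [Bool.xor_false, Bool.xor_false, c.hu, c'.hu, ← hiu]
        rfl
      · rw [Bool.xor_true, Bool.xor_true, c.hv, c'.hv, ← hπv]
        rfl
    have hf' : ψ f ≠ e' := fun h => hf (ψ.injective (h.trans hψe.symm))
    have h₀ : Γ.ep f b = Sum.inr c.vv := hfb.resolve_left fun h => hf (edge_eq_of_ep_inl h c.hu)
    have hw : (Lift.ofMix c).M (Γ.ep f b) = m := h₀ ▸ (Lift.ofMix c).map_W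
    have h₀' : Γ'.ep (ψ f) (xor (fl f) b) = Sum.inr c'.vv :=
      ((Lift.ofMix c').fiber _ ((hcompat.ep_eq hf b).trans hw)).resolve_left
        fun h => hf' (edge_eq_of_ep_inl h c'.hu)
    rw [h₀, h₀', ← hπv]
    rfl
  obtain ⟨φ, rfl, rfl, rfl, rfl⟩ :=
    (Lift.ofMix c).exists_bIso (Lift.ofMix c') ψ fl d π hcompat hM hep
  refine ⟨φ, (Lift.ofMix c).sign_eq_one (Lift.ofMix c') φ hcompat hM ?_, hψe⟩
  obtain ⟨q, hq⟩ := exists_slot c.hv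
  obtain ⟨β, hβ, hβ'⟩ := exists_perm_two (triBound_inr c.vv) (φ.ρ _) q _ (ρ_slot φ hq)
  rw [← Bool.xor_true c.be, hfle, hψe, Bool.xor_true] at hβ'
  change finSign (φ.ρ (Sum.inl c.iu)) * finSign (φ.ρ (Sum.inr c.vv)) * _ = _
  rw [finSign_eq_one (triBound_inl c.iu), one_mul, ← hβ, ← finSign_eq_sign β]
  refine finSign_mul_sign hc2 _ _ _ fun i => ?_
  obtain ⟨s, hsp, h₁, h₂⟩ := hβ' i
  have h := (Lift.ofMix c).local_rel (Lift.ofMix c') φ hcompat (Lift.ofMix c).map_W s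
    (edge_ne_of_slot_ne hq hsp (by rw [Bool.not_not, c.hu]; exact (Lift.ofMix c).ne))
  have e₁ : (Lift.ofMix c).J (Lift.ofMix c).W s = i.val := by
    refine (if_pos rfl).trans ?_
    rw [cmp_eq_of_anch hq]; omega
  have e₂ : (Lift.ofMix c').J (vmap φ.k φ.π (Lift.ofMix c).W) (φ.ρ (Lift.ofMix c).W s) =
      (β i).val := by
    refine (if_pos (congrArg Sum.inr hπv)).trans ?_
    change ((φ.ρ (Sum.inr c.vv) s).val + 3 - _) % 3 - 1 = _
    omega
  simp only [e₁, e₂] at h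
  exact h

end Mix

section Wil

variable {n t : ℕ} {m : Fin n ⊕ Fin t} {Δ : BDiag n t (quadBound n t m)}

theorem CollapseWil_ν_eq {Γ : Tri (n + 1) t} {i₀ : Fin (n + 1)} (c : CollapseWil Γ i₀ Δ)
    (j : Fin (n + 1)) : (c.ν (i₀ + 1 + j)).val = (c.x.val + j.val) % n := by
  induction j using Fin.induction with
  | zero => rw [add_zero, c.hν1, Fin.val_zero, add_zero, Nat.mod_eq_of_lt c.x.2]
  | succ j ih =>
    have hne : i₀ + 1 + j.castSucc ≠ i₀ := by
      rw [add_assoc, add_comm 1, Fin.coeSucc_eq_succ]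
      simp [Fin.succ_ne_zero]
    rw [← Fin.coeSucc_eq_succ, ← add_assoc, c.hνsucc _ hne, ih, Fin.coeSucc_eq_succ, Fin.val_succ,
      Fin.val_castSucc, Nat.mod_add_mod, add_assoc]

theorem exists_fin_offset (i₀ a : Fin (n + 1)) : ∃ j, a = i₀ + 1 + j :=
  ⟨a - (i₀ + 1), by abel⟩

/-- The lift underlying the collapse of a Wilson edge. -/
def Lift.ofWil {Γ : Tri (n + 1) t} {i₀ : Fin (n + 1)} (c : CollapseWil Γ i₀ Δ) : Lift m Γ Δ where
  M := Sum.map c.ν id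
  U := Sum.inl i₀
  W := Sum.inl (i₀ + 1)
  ne := by
    have := Δ.npos
    obtain ⟨n, rfl⟩ := Nat.exists_eq_succ_of_ne_zero this.ne'
    simp
  map_U := by simp [c.hν0, c.hm]
  map_W := by simp [c.hν1, c.hm]
  inj := by
    have hm := c.hm
    rintro (a | a) (b | b) hab ha <;>
      simp only [Sum.map_inl, Sum.map_inr, reduceCtorEq] at hab ha
    · have hab := congrArg Fin.val (Sum.inl_injective hab)
      have ha : (c.ν a).val ≠ c.x.val := fun h => ha (by rw [Fin.ext h]; exact hm.symm)
      obtain ⟨j, rfl⟩ := exists_fin_offset i₀ a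
      obtain ⟨j', rfl⟩ := exists_fin_offset i₀ b
      rw [CollapseWil_ν_eq, CollapseWil_ν_eq] at hab
      rw [CollapseWil_ν_eq] at ha
      have hx := c.x.2
      have hj : j.val % n = j'.val % n := Nat.ModEq.add_left_cancel' _ hab
      have hj₁ : j.val ≠ n := fun h => ha (by
        rw [h, Nat.add_mod_right, Nat.mod_eq_of_lt hx])
      have hj₀ : j.val % n ≠ 0 := fun h => ha (by
        rw [Nat.add_mod, h, add_zero, Nat.mod_mod, Nat.mod_eq_of_lt hx])
      have hj₂ : j'.val ≠ n := fun h => hj₀ (by rw [hj, h, Nat.mod_self])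
      rw [Nat.mod_eq_of_lt (by omega), Nat.mod_eq_of_lt (by omega)] at hj
      rw [Fin.ext hj]
    · exact congrArg Sum.inr (Sum.inr_injective hab)
  fiber := by
    have hm := c.hm
    rintro (a | a) h
    · have h : (c.ν a).val = c.x.val := congrArg Fin.val (Sum.inl_injective (h.trans hm))
      obtain ⟨j, rfl⟩ := exists_fin_offset i₀ a
      rw [CollapseWil_ν_eq] at h
      by_cases hj : j = 0
      · exact Or.inr (by rw [hj, add_zero])
      · left
        have hx := c.x.2
        have hj' : j.val ≠ 0 := fun h => hj (Fin.ext h)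
        have hjn : j.val = n := by
          by_contra hjn
          by_cases hlt : c.x.val + j.val < n
          · rw [Nat.mod_eq_of_lt hlt] at h; omega
          · rw [Nat.mod_eq_sub_mod (by omega), Nat.mod_eq_of_lt (by omega)] at h; omega
        have : j = Fin.last n := Fin.ext hjn
        rw [this, add_assoc, add_comm 1, Fin.last_add_one, add_zero]
    · exact absurd (h.trans hm) Sum.inr_ne_inl
  surj := by
    refine Sum.map_surjective.2 ⟨fun y => ?_, Function.surjective_id⟩
    have hx := c.x.2
    have hy := y.2
    by_cases hxy : c.x.val ≤ y.val
    · refine ⟨i₀ + 1 + ⟨y.val - c.x.val, by omega⟩, Fin.ext ?_⟩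
      rw [CollapseWil_ν_eq]
      change (c.x.val + (y.val - c.x.val)) % n = _
      rw [Nat.mod_eq_of_lt (by omega)]
      omega
    · refine ⟨i₀ + 1 + ⟨y.val + n - c.x.val, by omega⟩, Fin.ext ?_⟩
      rw [CollapseWil_ν_eq]
      change (c.x.val + (y.val + n - c.x.val)) % n = _
      rw [show c.x.val + (y.val + n - c.x.val) = y.val + n by omega, Nat.add_mod_right,
        Nat.mod_eq_of_lt hy]
  bound := by
    rintro v hv
    rw [quadBound_of_ne hv]
    cases v <;> rfl
  N _ := True
  ends := fun f hf => absurd trivial hf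
  φE := (Equiv.subtypeUnivEquiv fun _ => trivial).trans c.φE
  g := c.g
  hep f := c.hep f.1
  J v s := if v = Sum.inl i₀ then 0 else if v = Sum.inl (i₀ + 1) then 1 else s
  J_eq := by
    intro v s hv
    rw [if_neg, if_neg]
    · rintro rfl; exact hv (by simp [c.hν1, c.hm])
    · rintro rfl; exact hv (by simp [c.hν0, c.hm])
  ρ := c.ρ
  hsgn := c.hsgn
  hcmp f := c.hcmp f.1

/-- Collapses of Wilson edges onto `Δ` that order the two slots at the 4-valent vertex in the same
way are equivalent. -/
theorem exists_bIso_of_collapseWil {Γ Γ' : Tri (n + 1) t} {i₀ i₀' : Fin (n + 1)}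
    (c : CollapseWil Γ i₀ Δ) (c' : CollapseWil Γ' i₀' Δ) (hρ : c.ρ m = c'.ρ m) :
    ∃ φ : BIso Γ Γ', φ.sign = 1 ∧ i₀ + φ.k = i₀' := by
  obtain ⟨ψ, hψ⟩ : ∃ ψ : Γ.E ≃ Γ'.E, ψ = c.φE.trans c'.φE.symm := ⟨_, rfl⟩
  obtain ⟨fl, hfl⟩ : ∃ fl : Γ.E → Bool, fl = fun f => xor (c'.g (ψ f)) (c.g f) := ⟨_, rfl⟩
  obtain ⟨k, hk⟩ : ∃ k, i₀ + k = i₀' := ⟨i₀' - i₀, by abel⟩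
  have hk' : i₀ + 1 + k = i₀' + 1 := by rw [← hk]; abel
  have hx : c'.x = c.x := Sum.inl_injective (c'.hm.symm.trans c.hm)
  have hcompat : Lift.Compat (Lift.ofWil c) (Lift.ofWil c') ψ fl := by
    refine fun f hf => ⟨trivial, ?_, ?_⟩
    · change c'.φE (ψ f) = c.φE f
      rw [hψ, Equiv.trans_apply, Equiv.apply_symm_apply]
    · rw [hfl]
      change xor (c'.g (ψ f)) (xor (c'.g (ψ f)) (c.g f)) = c.g f
      rw [← Bool.xor_assoc, Bool.xor_self, Bool.false_xor]
  have hM : ∀ v, (Lift.ofWil c').M (vmap k 1 v) = (Lift.ofWil c).M v := by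
    rintro (a | a)
    · refine congrArg Sum.inl (Fin.ext ?_)
      obtain ⟨j, rfl⟩ := exists_fin_offset i₀ a
      change (c'.ν (i₀ + 1 + j + k)).val = (c.ν (i₀ + 1 + j)).val
      rw [CollapseWil_ν_eq c, add_right_comm (i₀ + 1) j k, hk', CollapseWil_ν_eq c', hx]
    · rfl
  have hJ : ∀ {Γ₀ : Tri (n + 1) t} {j₀ : Fin (n + 1)} (c₀ : CollapseWil Γ₀ j₀ Δ) (s : ℕ),
      (Lift.ofWil c₀).J (Sum.inl j₀) s = 0 ∧ (Lift.ofWil c₀).J (Sum.inl (j₀ + 1)) s = 1 :=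
    fun c₀ s => ⟨if_pos rfl, (if_neg (Lift.ofWil c₀).ne.symm).trans (if_pos rfl)⟩
  have hep : ∀ f b, Γ.ep f b = Sum.inl i₀ ∨ Γ.ep f b = Sum.inl (i₀ + 1) →
      Γ'.ep (ψ f) (xor (fl f) b) = vmap k 1 (Γ.ep f b) := by
    intro f b hfb
    have hw : (Lift.ofWil c).M (Γ.ep f b) = m := by
      rcases hfb with h | h <;> rw [h]
      exacts [(Lift.ofWil c).map_U, (Lift.ofWil c).map_W]
    have hfb' : Γ'.ep (ψ f) (xor (fl f) b) = Sum.inl i₀' ∨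
        Γ'.ep (ψ f) (xor (fl f) b) = Sum.inl (i₀' + 1) :=
      (Lift.ofWil c').fiber _ ((hcompat.ep_eq trivial b).trans hw)
    obtain ⟨h₁, h₂, h⟩ := hcompat.cmp_eq (f := f) trivial b rfl rfl hw
    change (c.ρ m _).val = (c'.ρ m _).val at h
    rw [hρ] at h
    have h := congrArg Fin.val ((c'.ρ m).injective (Fin.ext h))
    simp only at h
    rcases hfb with h₀ | h₀ <;> rcases hfb' with h₀' | h₀' <;> rw [h₀, h₀'] at h ⊢
    · exact congrArg Sum.inl hk.symm
    · rw [(hJ c _).1, (hJ c' _).2] at h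
      exact absurd h zero_ne_one
    · rw [(hJ c _).2, (hJ c' _).1] at h
      exact absurd h one_ne_zero
    · exact congrArg Sum.inl hk'.symm
  obtain ⟨φ, rfl, rfl, rfl, hπ⟩ :=
    (Lift.ofWil c).exists_bIso (Lift.ofWil c') ψ fl k 1 hcompat hM hep
  rw [← hπ] at hM
  refine ⟨φ, (Lift.ofWil c).sign_eq_one (Lift.ofWil c') φ hcompat hM ?_, hk⟩
  change finSign (φ.ρ (Sum.inl i₀)) * finSign (φ.ρ (Sum.inl (i₀ + 1))) * _ = _
  rw [finSign_eq_one (triBound_inl i₀), finSign_eq_one (triBound_inl (i₀ + 1)), one_mul, one_mul]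
  exact congrArg _ hρ.symm

end Wil

theorem exists_order_type {c : ℕ} (hc : c = 2) :
    ∃ ty : Perm (Fin c) → Bool, Function.Injective ty := by
  subst hc
  exact ⟨fun r => decide (r 0 = 0), by decide⟩

/-- The trivalent diagram consisting of a single chord. -/
def chord : Tri 2 0 where
  E := Unit
  anch :=
    { toFun := fun h => ⟨Sum.inl (if h.2 then 1 else 0), (0 : Fin 1)⟩
      invFun := fun y => ((), y.1.elim (fun i => decide (i = 1)) fun i => i.elim0)
      left_inv := by rintro ⟨⟨⟩, b⟩; cases b <;> rfl
      right_inv := by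
        rintro ⟨i | i, s⟩
        · obtain rfl : s = (0 : Fin 1) := Subsingleton.elim (α := Fin 1) _ _
          fin_cases i <;> rfl
        · exact i.elim0 }
  npos := two_pos
  conn := by
    have : ∀ u v : Fin 2 ⊕ Fin 0, u = v ∨ (u = Sum.inl 0 ∧ v = Sum.inl 1) ∨
        (u = Sum.inl 1 ∧ v = Sum.inl 0) := by decide
    refine @SimpleGraph.Connected.mk _ _ (fun u v => ?_) ⟨Sum.inl 0⟩
    by_cases huv : u = v
    · rw [huv]
    · refine SimpleGraph.Adj.reachable ((SimpleGraph.fromRel_adj _ _ _).2 ⟨huv, Or.inl (Or.inr ?_)⟩)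
      rcases this u v with h | ⟨rfl, rfl⟩ | ⟨rfl, rfl⟩
      · exact absurd h huv
      · exact ⟨0, 1, rfl, rfl, rfl⟩
      · exact ⟨1, 0, rfl, rfl, rfl⟩

/-- If lifts are classified by three types, with lifts of the same type equivalent, then three
representatives suffice. -/
theorem exists_representatives {ι : Type*} {S : ι → Prop} {r : ι → ι → Prop} [Nonempty ι]
    (T : ι → Fin 3 → Prop) (hT : ∀ R, S R → ∃ i, T R i)
    (hr : ∀ R R' i, T R i → T R' i → r R R') :
    ∃ P : Fin 3 → ι, ∀ R, S R → ∃ i, r R (P i) := by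
  classical
  refine ⟨fun i => if h : ∃ R, T R i then h.choose else Classical.arbitrary ι, fun R hR => ?_⟩
  obtain ⟨i, hi⟩ := hT R hR
  have h : ∃ R, T R i := ⟨R, hi⟩
  exact ⟨i, by simpa only [dif_pos h] using hr _ _ i hi h.choose_spec⟩

theorem pairEquivS_inl {p : ℕ × ℕ} {Γ Γ' : Tri p.1 p.2} {e : Γ.E} {e' : Γ'.E}
    (h : ∃ φ : BIso Γ Γ', φ.sign = 1 ∧ φ.ψ e = e') :
    PairEquivS ⟨p, Γ, Sum.inl e⟩ ⟨p, Γ', Sum.inl e'⟩ := by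
  obtain ⟨φ, h₁, h₂⟩ := h
  exact ⟨rfl, φ, h₁, congrArg Sum.inl h₂⟩

theorem pairEquivS_inr {p : ℕ × ℕ} {Γ Γ' : Tri p.1 p.2} {i i' : Fin p.1}
    (h : ∃ φ : BIso Γ Γ', φ.sign = 1 ∧ i + φ.k = i') :
    PairEquivS ⟨p, Γ, Sum.inr i⟩ ⟨p, Γ', Sum.inr i'⟩ := by
  obtain ⟨φ, h₁, h₂⟩ := h
  exact ⟨rfl, φ, h₁, congrArg Sum.inr h₂⟩

theorem collPair_cases {n t : ℕ} {m : Fin n ⊕ Fin t} {Δ : BDiag n t (quadBound n t m)}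
    {R : SPair} (h : CollPair R ⟨(n, t), m, Δ⟩) :
    (∃ (Γ : Tri n (t + 1)) (e : Γ.E), R = ⟨(n, t + 1), Γ, Sum.inl e⟩ ∧
      (Nonempty (CollapseInt Γ e Δ) ∨ Nonempty (CollapseMix Γ e Δ))) ∨
    ∃ (Γ : Tri (n + 1) t) (i : Fin (n + 1)), R = ⟨(n + 1, t), Γ, Sum.inr i⟩ ∧
      Nonempty (CollapseWil Γ i Δ) := by
  obtain ⟨p, Γ, e | i⟩ := R <;> dsimp only [CollPair] at h <;> rcases h with ⟨rfl, h⟩ | ⟨rfl, h⟩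
  · exact Or.inl ⟨Γ, e, rfl, h⟩
  · exact h.elim
  · exact h.elim
  · exact Or.inr ⟨Γ, i, rfl, h⟩

end WilsonLift

/- STATEMENT 1: Let `Γ_x` be a V-oriented Wilson graph with exactly one
4-valent vertex and all other vertices trivalent.  Then, up to equivalence of
pairs (isomorphism of V-oriented Wilson graphs carrying the distinguished
admissible edge of one to that of the other), there are at most three pairs
`(Γ, e)` of a trivalent V-oriented Wilson graph `Γ` and an admissible edge `e`
whose collapse `δ_e Γ` is `Γ_x`. -/
theorem at_most_three_lifts (Q : QuadS) :
    ∃ P : Fin 3 → SPair,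
      ∀ R : SPair, CollPair R Q → ∃ i : Fin 3, PairEquivS R (P i) := by
  have : Nonempty SPair := ⟨⟨(2, 0), WilsonLift.chord, Sum.inr 0⟩⟩
  obtain ⟨⟨n, t⟩, m, Δ⟩ := Q
  obtain ⟨x, hm⟩ | ⟨x, hm⟩ : (∃ x, m = Sum.inl x) ∨ ∃ x, m = Sum.inr x := by cases m <;> simp
  · obtain ⟨ty, hty⟩ := WilsonLift.exists_order_type (WilsonLift.quadBound_self_inl hm)
    refine WilsonLift.exists_representatives (fun R i =>
      (i = 0 ∧ ∃ (Γ : Tri n (t + 1)) (e : Γ.E), R = ⟨(n, t + 1), Γ, Sum.inl e⟩ ∧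
        Nonempty (CollapseMix Γ e Δ)) ∨
      ∃ (Γ : Tri (n + 1) t) (j : Fin (n + 1)), R = ⟨(n + 1, t), Γ, Sum.inr j⟩ ∧
        ∃ c : CollapseWil Γ j Δ, i = if ty (c.ρ m) then 1 else 2) ?_ ?_
    · intro R hR
      rcases WilsonLift.collPair_cases hR with ⟨Γ, e, rfl, ⟨⟨c⟩⟩ | hc⟩ | ⟨Γ, j, rfl, ⟨c⟩⟩
      · exact absurd (hm.symm.trans c.hm) Sum.inl_ne_inr
      · exact ⟨0, Or.inl ⟨rfl, Γ, e, rfl, hc⟩⟩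
      · exact ⟨_, Or.inr ⟨Γ, j, rfl, c, rfl⟩⟩
    · rintro R R' i (⟨rfl, Γ, e, rfl, ⟨c⟩⟩ | ⟨Γ, j, rfl, c, rfl⟩)
        (⟨hi, Γ', e', rfl, ⟨c'⟩⟩ | ⟨Γ', j', rfl, c', hi⟩)
      · exact WilsonLift.pairEquivS_inl (WilsonLift.exists_bIso_of_collapseMix c c')
      · split_ifs at hi <;> simp at hi
      · split_ifs at hi <;> simp at hi
      · refine WilsonLift.pairEquivS_inr
          (WilsonLift.exists_bIso_of_collapseWil c c' (hty ?_))
        cases h : ty (c.ρ m) <;> cases h' : ty (c'.ρ m) <;> simp [h, h'] at hi ⊢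
  · obtain ⟨ty, hty⟩ := WilsonLift.exists_pairing (WilsonLift.quadBound_self_inr hm)
    refine WilsonLift.exists_representatives (fun R i =>
      ∃ (Γ : Tri n (t + 1)) (e : Γ.E), R = ⟨(n, t + 1), Γ, Sum.inl e⟩ ∧
        ∃ c : CollapseInt Γ e Δ, ty (c.ρ m) = i) ?_ ?_
    · intro R hR
      rcases WilsonLift.collPair_cases hR with ⟨Γ, e, rfl, ⟨⟨c⟩⟩ | ⟨⟨c⟩⟩⟩ | ⟨Γ, j, rfl, ⟨c⟩⟩
      · exact ⟨_, Γ, e, rfl, c, rfl⟩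
      · exact absurd (hm.symm.trans c.hm) Sum.inr_ne_inl
      · exact absurd (hm.symm.trans c.hm) Sum.inr_ne_inl
    · rintro R R' i ⟨Γ, e, rfl, c, rfl⟩ ⟨Γ', e', rfl, c', hi⟩
      obtain ⟨sw, hsw⟩ := hty _ _ hi.symm
      exact WilsonLift.pairEquivS_inl (WilsonLift.exists_bIso_of_collapseInt c c' sw hsw)
end

section
/- Let Γ be a trivalent V-oriented Wilson graph and e, f ∈ E_Γ admissible edges; set Γ_x = δ_eΓ and let Γ_x^1, Γ_x^2, Γ_x^3 be the lifts of Γ_x. Then δ_eΓ ∼ ±δ_fΓ (isomorphic as V-oriented Wilson graphs, with the indicated sign of V-orientation) if and only if there exist i ∈ {1,2,3} and a pair (ρ,σ) of permutations of V_Γ and of E_Γ such that (ρ,σ)·Γ = ±Γ_x^i and σ(f) = e. -/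
/-! ### Signatures of bijections between finite ordinals -/

section FinSign

open Equiv

/-- The signature of a bijection between two finite ordinals (necessarily equal). -/
def finSign {a b : ℕ} (e : Fin a ≃ Fin b) : ℤˣ :=
  Perm.sign (e.trans (finCongr (by simpa using (Fintype.card_congr e).symm)))

theorem finSign_perm {a : ℕ} (e : Perm (Fin a)) : finSign e = Perm.sign e := rfl

theorem finSign_trans {a b c : ℕ} (e : Fin a ≃ Fin b) (f : Fin b ≃ Fin c) :
    finSign (e.trans f) = finSign e * finSign f := by
  obtain rfl : a = b := by simpa using Fintype.card_congr e
  obtain rfl : a = c := by simpa using Fintype.card_congr f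
  rw [finSign_perm, finSign_perm, finSign_perm, Perm.sign_trans, mul_comm]

theorem finSign_finCongr {a b : ℕ} (h : a = b) : finSign (finCongr h) = 1 := by
  subst h
  exact Perm.sign_refl

theorem finSign_symm {a b : ℕ} (e : Fin a ≃ Fin b) : finSign e.symm = finSign e := by
  obtain rfl : a = b := by simpa using Fintype.card_congr e
  exact Perm.sign_symm e

theorem finSign_eq_one_of_subsingleton {a b : ℕ} (ha : a = 1) (e : Fin a ≃ Fin b) :
    finSign e = 1 := by
  obtain rfl : a = b := by simpa using Fintype.card_congr e
  subst ha
  rw [finSign_perm, Subsingleton.elim e 1, Perm.sign_one]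

/-- Conjugating a permutation by casts of finite ordinals does not change its signature. -/
theorem finSign_finCongr_trans {a b c : ℕ} (ha : a = c) (hb : c = b) (P : Perm (Fin c)) :
    finSign (((finCongr ha).trans P).trans (finCongr hb)) = Perm.sign P := by
  rw [finSign_trans, finSign_trans, finSign_finCongr, finSign_finCongr, one_mul, mul_one,
    finSign_perm]

theorem sigma_fin_ext {V : Type*} {bd : V → ℕ} {x y : (v : V) × Fin (bd v)}
    (h₁ : x.1 = y.1) (h₂ : (x.2 : ℕ) = y.2) : x = y := by
  obtain ⟨v, i⟩ := x
  obtain ⟨w, j⟩ := y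
  obtain rfl : v = w := h₁
  obtain rfl : i = j := Fin.ext h₂
  rfl

theorem fin_family_congr {V : Type*} {bd bd' : V → ℕ}
    (ρ : (v : V) → Fin (bd v) ≃ Fin (bd' v)) {v w : V} (h : v = w)
    {i : Fin (bd v)} {j : Fin (bd w)} (hij : (i : ℕ) = j) :
    (ρ v i : ℕ) = ρ w j := by
  subst h
  rw [Fin.ext hij]

/-- A family of local reorderings `ρ` of total sign `1`, transported along a bijection `θ` of
vertices, where the new reference positions `i'` differ from the old ones by local bijections of
the same total sign as `σ`. -/
theorem exists_transported_reordering {V H : Type*} [Fintype V] {θ : V → V}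
    (hθ : Function.Bijective θ) {bd bd' : V → ℕ} {s : V → ℤˣ} {v : H → V} {i j i' j' : H → ℕ}
    (ρ : (v : V) → Perm (Fin (bd v))) (hρ : ∏ v, Perm.sign (ρ v) = 1)
    (hj : ∀ h, ∃ hlt : i h < bd (v h), j h = (ρ (v h) ⟨i h, hlt⟩ : Fin _).val)
    (σ : (v : V) → Fin (bd v) ≃ Fin (bd' (θ v)))
    (hj' : ∀ h, ∃ hlt : j h < bd (v h), j' h = (σ (v h) ⟨j h, hlt⟩ : Fin _).val)
    (hi' : ∀ v₀, ∃ P : Fin (bd v₀) ≃ Fin (bd' (θ v₀)), finSign P = s v₀ ∧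
      ∀ h, v h = v₀ → ∀ hlt : i h < bd v₀, (P ⟨i h, hlt⟩ : Fin _).val = i' h)
    (hs : ∏ v, s v = ∏ v, finSign (σ v)) :
    ∃ ρ' : (v : V) → Perm (Fin (bd' v)), ∏ v, Perm.sign (ρ' v) = 1 ∧
      ∀ h, ∃ hlt : i' h < bd' (θ (v h)), j' h = (ρ' (θ (v h)) ⟨i' h, hlt⟩ : Fin _).val := by
  choose P hP hPi using hi'
  let F : (v : V) → Perm (Fin (bd' (θ v))) := fun v => (P v).symm.trans ((ρ v).trans (σ v))
  let Θ : V ≃ V := Equiv.ofBijective θ hθ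
  let ρ' : (v : V) → Perm (Fin (bd' v)) :=
    Equiv.piCongrLeft (fun v => Perm (Fin (bd' v))) Θ F
  have hρ' : ∀ v, ρ' (θ v) = F v := fun v =>
    Equiv.piCongrLeft_apply_apply (fun v => Perm (Fin (bd' v))) Θ F v
  refine ⟨ρ', ?_, fun h => ?_⟩
  · have hF : ∀ v, Perm.sign (F v) = s v * (Perm.sign (ρ v) * finSign (σ v)) := fun v => by
      rw [← finSign_perm, finSign_trans, finSign_trans, finSign_symm, hP, finSign_perm]
    rw [← Equiv.prod_comp Θ]
    calc ∏ v, Perm.sign (ρ' (Θ v)) = ∏ v, s v * (Perm.sign (ρ v) * finSign (σ v)) :=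
          Finset.prod_congr rfl fun v _ => by rw [← hF, ← hρ' v]; rfl
      _ = 1 := by
          rw [Finset.prod_mul_distrib, Finset.prod_mul_distrib, hρ, hs, one_mul,
            Int.units_mul_self]
  · obtain ⟨hi, hj⟩ := hj h
    obtain ⟨hlt, hj'⟩ := hj' h
    have hPh := hPi (v h) h rfl hi
    refine ⟨hPh ▸ Fin.isLt _, ?_⟩
    have hsymm : (P (v h)).symm ⟨i' h, hPh ▸ Fin.isLt _⟩ = ⟨i h, hi⟩ := by
      rw [Equiv.symm_apply_eq]
      exact Fin.ext hPh.symm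
    rw [hρ', hj']
    simp only [F, Equiv.trans_apply, hsymm]
    congr 2
    exact Fin.ext hj

end FinSign

/-! ### Isomorphisms of Wilson diagrams form a groupoid -/

section BIso

open Equiv

variable {n t : ℕ} {bd bd' bd'' : Fin n ⊕ Fin t → ℕ}
  {Γ : BDiag n t bd} {Γ' : BDiag n t bd'} {Γ'' : BDiag n t bd''}

theorem vmap_bijective [NeZero n] (k : Fin n) (π : Perm (Fin t)) :
    Function.Bijective (vmap k π) :=
  (Equiv.sumCongr (Equiv.addRight k) π).bijective

theorem vmap_vmap [NeZero n] (k k' : Fin n) (π π' : Perm (Fin t)) (v : Fin n ⊕ Fin t) :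
    vmap k' π' (vmap k π v) = vmap (k + k') (π.trans π') v := by
  rcases v with i | y <;> simp [vmap, add_assoc]

theorem BIso.sign_eq (φ : BIso Γ Γ') : φ.sign = ∏ v, finSign (φ.ρ v) := rfl

theorem BIso.ep_map (φ : BIso Γ Γ') (e : Γ.E) (b : Bool) :
    Γ'.ep (φ.ψ e) (xor (φ.fl e) b) = vmap φ.k φ.π (Γ.ep e b) := by
  simp only [BDiag.ep, φ.hanch]

theorem BDiag.cmp_lt (Γ : BDiag n t bd) {e : Γ.E} {b : Bool} {w : Fin n ⊕ Fin t}
    (hw : Γ.ep e b = w) : Γ.cmp e b < bd w := hw ▸ (Γ.anch (e, b)).2.isLt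

theorem BIso.cmp_map (φ : BIso Γ Γ') {e : Γ.E} {b : Bool} {w : Fin n ⊕ Fin t}
    (hw : Γ.ep e b = w) :
    Γ'.cmp (φ.ψ e) (xor (φ.fl e) b) = (φ.ρ w ⟨Γ.cmp e b, Γ.cmp_lt hw⟩ : Fin _).val := by
  subst hw
  exact congrArg (fun x => (x.2 : ℕ)) (φ.hanch e b)

theorem BDiag.eq_of_ep_eq_of_cmp_eq (Γ : BDiag n t bd) {e f : Γ.E} {b d : Bool}
    (hep : Γ.ep e b = Γ.ep f d) (hcmp : Γ.cmp e b = Γ.cmp f d) : e = f :=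
  congrArg Prod.fst (Γ.anch.injective (sigma_fin_ext hep hcmp))

theorem BIso.exists_trans (φ : BIso Γ Γ') (χ : BIso Γ' Γ'') :
    ∃ ω : BIso Γ Γ'', ω.sign = φ.sign * χ.sign ∧ ω.ψ = φ.ψ.trans χ.ψ ∧ ω.k = φ.k + χ.k := by
  have : NeZero n := ⟨Γ.npos.ne'⟩
  have hv := vmap_vmap φ.k χ.k φ.π χ.π
  refine ⟨{
    ψ := φ.ψ.trans χ.ψ
    fl := fun e => xor (χ.fl (φ.ψ e)) (φ.fl e)
    k := φ.k + χ.k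
    π := φ.π.trans χ.π
    ρ := fun v => ((φ.ρ v).trans (χ.ρ (vmap φ.k φ.π v))).trans
      (finCongr (congrArg bd'' (hv v)))
    hanch := fun e b => ?_ }, ?_, rfl, rfl⟩
  · rw [Equiv.trans_apply, Bool.xor_assoc, χ.hanch]
    refine sigma_fin_ext ?_ ?_
    · simp only [φ.hanch, hv]
    · refine fin_family_congr χ.ρ ?_ ?_ <;> rw [φ.hanch]
  · simp only [BIso.sign_eq, finSign_trans, finSign_finCongr, mul_one, Finset.prod_mul_distrib]
    congr 1
    exact (vmap_bijective φ.k φ.π).prod_comp fun v => finSign (χ.ρ v)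

theorem BIso.exists_symm (φ : BIso Γ Γ') :
    ∃ ω : BIso Γ' Γ, ω.sign = φ.sign ∧ ω.ψ = φ.ψ.symm ∧ ω.k = -φ.k := by
  have : NeZero n := ⟨Γ.npos.ne'⟩
  have hv : ∀ v, vmap φ.k φ.π (vmap (-φ.k) φ.π.symm v) = v := fun v => by
    rcases v with i | y <;> simp [vmap]
  have hv' : ∀ v, vmap (-φ.k) φ.π.symm (vmap φ.k φ.π v) = v := fun v => by
    rcases v with i | y <;> simp [vmap]
  refine ⟨{
    ψ := φ.ψ.symm
    fl := fun e => φ.fl (φ.ψ.symm e)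
    k := -φ.k
    π := φ.π.symm
    ρ := fun v => (finCongr (congrArg bd' (hv v).symm)).trans
      (φ.ρ (vmap (-φ.k) φ.π.symm v)).symm
    hanch := fun e b => ?_ }, ?_, rfl, rfl⟩
  · obtain ⟨e, rfl⟩ := φ.ψ.surjective e
    obtain ⟨b, rfl⟩ : ∃ d, b = xor (φ.fl e) d := ⟨xor (φ.fl e) b, by simp⟩
    rw [Equiv.symm_apply_apply, ← Bool.xor_assoc, Bool.xor_self, Bool.false_xor]
    refine sigma_fin_ext ?_ ?_
    · simp only [φ.hanch, hv']
    · rw [show Γ.anch (e, b) = ⟨_, (φ.ρ (Γ.anch (e, b)).1).symm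
        (φ.ρ (Γ.anch (e, b)).1 (Γ.anch (e, b)).2)⟩ by rw [Equiv.symm_apply_apply]]
      refine fin_family_congr (fun v => (φ.ρ v).symm) ?_ ?_
      · simp only [φ.hanch, hv']
      · exact (congrArg (fun x => (x.2 : ℕ)) (φ.hanch e b)).symm
  · simp only [BIso.sign_eq, finSign_trans, finSign_finCongr, one_mul, finSign_symm]
    exact (vmap_bijective (-φ.k) φ.π.symm).prod_comp fun v => finSign (φ.ρ v)

/-- If some vertex carries at least two non-Wilson ends, local reorderings realise both signs. -/
theorem exists_reordering_sign_eq (v₀ : Fin n ⊕ Fin t) (hv₀ : 2 ≤ bd v₀)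
    (ε : ℤˣ) : ∃ σ : (v : Fin n ⊕ Fin t) → Perm (Fin (bd v)), ∏ v, Perm.sign (σ v) = ε := by
  obtain ⟨τ, hτ⟩ : ∃ τ : Perm (Fin (bd v₀)), Perm.sign τ = ε := by
    have : Nontrivial (Fin (bd v₀)) := Fin.nontrivial_iff_two_le.mpr hv₀
    exact Perm.sign_surjective _ ε
  refine ⟨Function.update (fun _ => 1) v₀ τ, ?_⟩
  rw [Fintype.prod_eq_single v₀, Function.update_self, hτ]
  intro v hv
  rw [Function.update_of_ne hv, Perm.sign_one]

/-- A Wilson diagram can be relabelled by any permutation of its internal vertices, with any change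
of sign of its V-orientation, provided some vertex carries at least two non-Wilson ends. -/
theorem BDiag.exists_relabel (Γ : BDiag n t bd) (π : Perm (Fin t))
    (hbd : ∀ v, bd' (Sum.map id π v) = bd v) (v₀ : Fin n ⊕ Fin t) (hv₀ : 2 ≤ bd v₀) (ε : ℤˣ) :
    ∃ (Γ' : BDiag n t bd') (φ : BIso Γ Γ'), φ.sign = ε ∧ φ.π = π := by
  have : NeZero n := ⟨Γ.npos.ne'⟩
  obtain ⟨σ, hσ⟩ := exists_reordering_sign_eq v₀ hv₀ ε
  let θ : Fin n ⊕ Fin t ≃ Fin n ⊕ Fin t := Equiv.sumCongr (Equiv.refl _) π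
  have hθ : ∀ v, vmap 0 π v = θ v := by rintro (i | y) <;> simp [vmap, θ]
  have hinl : ∀ v i, θ v = Sum.inl i ↔ v = Sum.inl i := by rintro (j | y) i <;> simp [θ]
  let anch : Γ.E × Bool ≃ ((v : Fin n ⊕ Fin t) × Fin (bd' v)) :=
    Γ.anch.trans (Equiv.sigmaCongr θ fun v => (σ v).trans (finCongr (hbd v).symm))
  have hanch : ∀ x, (anch x).1 = θ (Γ.anch x).1 := fun _ => rfl
  refine ⟨{
    E := Γ.E
    anch := anch
    npos := Γ.npos
    conn := ?_ }, {
    ψ := Equiv.refl Γ.E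
    fl := fun _ => false
    k := 0
    π := π
    ρ := fun v => (σ v).trans (finCongr ((hbd v).symm.trans (congrArg bd' (hθ v).symm)))
    hanch := fun e b => ?_ }, ?_, rfl⟩
  · refine (SimpleGraph.Iso.connected_iff ⟨θ, fun {u v} => ?_⟩).mp Γ.conn
    simp only [SimpleGraph.fromRel_adj, hanch, hinl, θ.injective.eq_iff, Ne]
  · rw [Bool.false_xor]
    exact sigma_fin_ext (hθ _).symm rfl
  · simpa only [BIso.sign_eq, finSign_trans, finSign_finCongr, mul_one, finSign_perm] using hσ

end BIso

/-! ### Collapses are natural under isomorphisms -/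

section Transport

open Equiv

/-- The effect of a permutation of sign `s` of the three ends at a trivalent vertex on the cyclic
offset `r ∈ {1, 2}` from a marked end. -/
def turn (s : ℤˣ) (r : ℕ) : ℕ := if s = 1 then r else 3 - r

theorem cyclicOffset_map (α : Perm (Fin 3)) (c i : Fin 3) (h : i ≠ c) :
    ((α i : ℕ) + 3 - (α c : ℕ)) % 3 = turn (Perm.sign α) (((i : ℕ) + 3 - c) % 3) := by
  revert α c i
  unfold turn
  decide

theorem exists_perm_two (s : ℤˣ) : ∃ P : Perm (Fin 2), Perm.sign P = s ∧
    ∀ (r : Fin 3) (x : Fin 2), r ≠ 0 → (x : ℕ) = r - 1 → (P x : ℕ) = turn s r - 1 := by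
  refine ⟨if s = 1 then 1 else swap 0 1, ?_⟩
  revert s
  unfold turn
  decide

/-- The permutation of the four ends at the new vertex induced by permutations of given signs at
the two endpoints of the collapsed edge, the endpoints being exchanged if `fl`. -/
theorem exists_perm_four (fl : Bool) (s s' : ℤˣ) :
    ∃ P : Perm (Fin 4), Perm.sign P = s * s' ∧
      ∀ (r : Fin 3) (x : Fin 4), r ≠ 0 →
        ((x : ℕ) = r - 1 → (P x : ℕ) = if fl then turn s r + 1 else turn s r - 1) ∧
        ((x : ℕ) = r + 1 → (P x : ℕ) = if fl then turn s' r - 1 else turn s' r + 1) := by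
  refine ⟨(if fl then swap 0 2 * swap 1 3 else 1) * (if s' = 1 then 1 else swap 2 3) *
    (if s = 1 then 1 else swap 0 1), ?_⟩
  revert fl s s'
  unfold turn
  decide

section Trivalent

variable {n t : ℕ} {Γ Γ' : Tri n t}

theorem BIso.finSign_ρ_inl (φ : BIso Γ Γ') (i : Fin n) : finSign (φ.ρ (Sum.inl i)) = 1 :=
  finSign_eq_one_of_subsingleton rfl _

theorem BDiag.cmp_eq_zero {e : Γ.E} {b : Bool} {i : Fin n} (h : Γ.ep e b = Sum.inl i) :
    Γ.cmp e b = 0 :=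
  Nat.lt_one_iff.mp (Γ.cmp_lt h)

/-- Cyclic offsets between two ends at an internal vertex, under an isomorphism. -/
theorem BIso.cyclicOffset (φ : BIso Γ Γ') {e f : Γ.E} {b d : Bool} {y : Fin t}
    (he : Γ.ep e b = Sum.inr y) (hf : Γ.ep f d = Sum.inr y) (hne : f ≠ e) :
    ∃ r : Fin 3, r ≠ 0 ∧ (Γ.cmp f d + 3 - Γ.cmp e b) % 3 = r ∧
      (Γ'.cmp (φ.ψ f) (xor (φ.fl f) d) + 3 - Γ'.cmp (φ.ψ e) (xor (φ.fl e) b)) % 3 =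
        turn (finSign (φ.ρ (Sum.inr y))) r := by
  have hlt : Γ.cmp f d < 3 := Γ.cmp_lt hf
  have hlt' : Γ.cmp e b < 3 := Γ.cmp_lt he
  have hcne : Γ.cmp f d ≠ Γ.cmp e b := fun h =>
    hne (Γ.eq_of_ep_eq_of_cmp_eq (hf.trans he.symm) h)
  refine ⟨⟨(Γ.cmp f d + 3 - Γ.cmp e b) % 3, Nat.mod_lt _ (by norm_num)⟩, ?_, rfl, ?_⟩
  · intro h
    have := congrArg Fin.val h
    simp only [Fin.val_zero] at this
    omega
  · rw [φ.cmp_map he, φ.cmp_map hf]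
    exact cyclicOffset_map (φ.ρ (Sum.inr y)) ⟨_, hlt'⟩ ⟨_, hlt⟩ fun h => hcne (congrArg Fin.val h)

theorem BIso.prod_fiber_external (φ : BIso Γ Γ') {V : Type*} [DecidableEq V]
    (M : Fin n ⊕ Fin t → V) (v₀ : V) (hM : ∀ y, M (Sum.inr y) ≠ v₀) :
    ∏ w with M w = v₀, finSign (φ.ρ w) = 1 := by
  refine Finset.prod_eq_one fun w hw => ?_
  rcases w with i | y
  · exact φ.finSign_ρ_inl i
  · exact absurd (Finset.mem_filter.mp hw).2 (hM y)

/-- Comparison of positions at a vertex with at most one preimage, which is internal. -/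
theorem BIso.exists_slotEquiv (φ : BIso Γ Γ') {V : Type*} [DecidableEq V]
    (M : Fin n ⊕ Fin t → V) (v₀ : V) (hinl : ∀ i, M (Sum.inl i) ≠ v₀)
    (hinr : ∀ y y', M (Sum.inr y) = v₀ → M (Sum.inr y') = v₀ → y = y')
    {c c' : ℕ} (hc : c = 3) (hc' : c' = 3) :
    ∃ P : Fin c ≃ Fin c', finSign P = ∏ w with M w = v₀, finSign (φ.ρ w) ∧
      ∀ f d, M (Γ.ep f d) = v₀ → ∀ hlt : Γ.cmp f d < c,
        (P ⟨Γ.cmp f d, hlt⟩ : Fin _).val = Γ'.cmp (φ.ψ f) (xor (φ.fl f) d) := by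
  subst hc hc'
  by_cases h : ∃ y, M (Sum.inr y) = v₀
  · obtain ⟨y, hy⟩ := h
    have huniq : ∀ w, M w = v₀ → w = Sum.inr y := by
      rintro (i | y') hw
      · exact absurd hw (hinl i)
      · rw [hinr y' y hw hy]
    refine ⟨φ.ρ (Sum.inr y), ?_, fun f d hf hlt => (φ.cmp_map (huniq _ hf)).symm⟩
    rw [Finset.prod_eq_single (Sum.inr y)]
    · rfl
    · exact fun w hw hne => absurd (huniq w (Finset.mem_filter.mp hw).2) hne
    · exact fun hy' => (hy' (by simp [hy])).elim
  · push Not at h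
    refine ⟨Equiv.refl _, ?_, fun f d hf => ?_⟩
    · rw [φ.prod_fiber_external M v₀ h]
      exact Perm.sign_refl
    · rcases hw : Γ.ep f d with i | y
      · exact absurd (hw ▸ hf) (hinl i)
      · exact absurd (hw ▸ hf) (h y)

end Trivalent

theorem quadBound_external {n t : ℕ} {m v : Fin n ⊕ Fin t} {x : Fin n} (hm : m = Sum.inl x)
    (hv : v = m) : quadBound n t m v = 2 := by
  subst hv hm
  simp [quadBound]

theorem quadBound_internal {n t : ℕ} {m v : Fin n ⊕ Fin t} {x : Fin t} (hm : m = Sum.inr x)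
    (hv : v = m) : quadBound n t m v = 4 := by
  subst hv hm
  simp [quadBound]

theorem quadBound_of_ne {n t : ℕ} {m v : Fin n ⊕ Fin t} (h : v ≠ m) :
    quadBound n t m v = triBound n t v := by simp [quadBound, h]

/-- Isomorphisms preserve the 4-valent vertex. -/
theorem BIso.quad_vertex {n t : ℕ} {m m' : Fin n ⊕ Fin t}
    {Δ : BDiag n t (quadBound n t m)} {Δ' : BDiag n t (quadBound n t m')} (χ : BIso Δ Δ') :
    m' = vmap χ.k χ.π m := by
  by_contra hne
  have h : quadBound n t m m = quadBound n t m' (vmap χ.k χ.π m) := by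
    simpa using Fintype.card_congr (χ.ρ m)
  rw [quadBound_of_ne (Ne.symm hne)] at h
  rcases m with x | x
  · rw [quadBound_external rfl rfl] at h
    simp [vmap, triBound] at h
  · rw [quadBound_internal rfl rfl] at h
    simp [vmap, triBound] at h

variable {n t : ℕ}

theorem BIso.cmp_map_exists {bd bd' : Fin n ⊕ Fin t → ℕ} {Δ : BDiag n t bd} {Δ' : BDiag n t bd'}
    (χ : BIso Δ Δ') {e : Δ.E} {b : Bool} {w : Fin n ⊕ Fin t} (hw : Δ.ep e b = w) :
    ∃ hlt : Δ.cmp e b < bd w,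
      Δ'.cmp (χ.ψ e) (xor (χ.fl e) b) = (χ.ρ w ⟨Δ.cmp e b, hlt⟩ : Fin _).val :=
  ⟨Δ.cmp_lt hw, χ.cmp_map hw⟩

/-- The bijection of the edges other than `e` with those other than `ψ e`. -/
def edgesNe {E E' : Type} (ψ : E ≃ E') (e : E) : {f : E // f ≠ e} ≃ {f : E' // f ≠ ψ e} :=
  ψ.subtypeEquiv fun _ => (ψ.injective.ne_iff).symm

theorem edgesNe_symm_apply {E E' : Type} (ψ : E ≃ E') (e f : E) (h : ψ f ≠ ψ e) :
    (edgesNe ψ e).symm ⟨ψ f, h⟩ = ⟨f, fun hf => h (congrArg ψ hf)⟩ := by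
  rw [Equiv.symm_apply_eq]
  rfl

theorem exists_flip {E E' : Type} [DecidableEq E] (ψ : E ≃ E') (e : E) (fl : E → Bool)
    (G : {f : E // f ≠ e} → Bool) :
    ∃ g : E' → Bool, ∀ (f : E) (hf : f ≠ e) (b : Bool),
      xor (g (ψ f)) (xor (fl f) b) = xor (G ⟨f, hf⟩) b := by
  refine ⟨fun f' => if h : ψ.symm f' = e then false
    else xor (G ⟨ψ.symm f', h⟩) (fl (ψ.symm f')), fun f hf b => ?_⟩
  simp [hf]

theorem exists_position_congr {V : Type*} {bd : V → ℕ} (ρ : (v : V) → Perm (Fin (bd v)))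
    {v v' : V} {i j j' : ℕ} (hv : v = v') (hj : j = j')
    (h : ∃ hlt : i < bd v, j = (ρ v ⟨i, hlt⟩ : Fin _).val) :
    ∃ hlt : i < bd v', j' = (ρ v' ⟨i, hlt⟩ : Fin _).val := by
  subst hv hj
  exact h

/-- Every end of the target is the image of an end of the source. -/
theorem BIso.exists_end {bd bd' : Fin n ⊕ Fin t → ℕ} {Γ : BDiag n t bd} {Γ' : BDiag n t bd'}
    (φ : BIso Γ Γ') (f : Γ'.E) (b : Bool) :
    ∃ f₀ d, f = φ.ψ f₀ ∧ b = xor (φ.fl f₀) d :=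
  ⟨φ.ψ.symm f, xor (φ.fl (φ.ψ.symm f)) b, by simp, by simp⟩

theorem CollapseInt.transport {m m' : Fin n ⊕ Fin t} {Γ Γ' : Tri n (t+1)} {e : Γ.E}
    {Δ : BDiag n t (quadBound n t m)} {Δ' : BDiag n t (quadBound n t m')}
    (c : CollapseInt Γ e Δ) (φ : BIso Γ Γ') (χ : BIso Δ Δ') (hsign : φ.sign = χ.sign) :
    Nonempty (CollapseInt Γ' (φ.ψ e) Δ') := by
  have : NeZero n := ⟨Γ.npos.ne'⟩
  obtain ⟨uu, vv, hu, hv, hne, x, rfl, μ, hμu, hμv, hinj, hsurj, k, φE, g, hep, ρ, hsgn, hcmp⟩ := c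
  have hm' := χ.quad_vertex
  let M : Fin n ⊕ Fin (t+1) → Fin n ⊕ Fin t := Sum.map (· + k) μ
  let k' : Fin n := k + χ.k - φ.k
  let μ' : Fin (t+1) → Fin t := fun a => χ.π (μ (φ.π.symm a))
  let uu' : Fin (t+1) := φ.π (if φ.fl e then vv else uu)
  let vv' : Fin (t+1) := φ.π (if φ.fl e then uu else vv)
  have hM' : ∀ w, Sum.map (· + k') μ' (vmap φ.k φ.π w) = vmap χ.k χ.π (M w) := by
    rintro (i | y)
    · simp only [vmap, M, k', Sum.map_inl]
      congr 1
      abel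
    · simp [vmap, M, μ']
  have hcase : (φ.fl e = false ∧ uu' = φ.π uu ∧ vv' = φ.π vv) ∨
      (φ.fl e = true ∧ uu' = φ.π vv ∧ vv' = φ.π uu) := by
    rcases hfl : φ.fl e <;> simp [uu', vv', hfl]
  -- positions of the ends away from the collapsed edge
  have hind : ∀ f d, Γ.ep f d ≠ Sum.inr uu → Γ.ep f d ≠ Sum.inr vv →
      indCmpInt Γ e uu vv f d = Γ.cmp f d := fun f d h₁ h₂ => by simp [indCmpInt, h₁, h₂]
  have hind' : ∀ f d, Γ.ep f d ≠ Sum.inr uu → Γ.ep f d ≠ Sum.inr vv →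
      indCmpInt Γ' (φ.ψ e) uu' vv' (φ.ψ f) (xor (φ.fl f) d) =
        Γ'.cmp (φ.ψ f) (xor (φ.fl f) d) := fun f d h₁ h₂ => by
    have hinjv := (vmap_bijective φ.k φ.π).injective
    have h₁' : Γ'.ep (φ.ψ f) (xor (φ.fl f) d) ≠ Sum.inr (φ.π uu) := fun h =>
      h₁ (hinjv ((φ.ep_map f d).symm.trans h))
    have h₂' : Γ'.ep (φ.ψ f) (xor (φ.fl f) d) ≠ Sum.inr (φ.π vv) := fun h =>
      h₂ (hinjv ((φ.ep_map f d).symm.trans h))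
    rcases hcase with ⟨-, hu', hv'⟩ | ⟨-, hu', hv'⟩ <;> simp [indCmpInt, hu', hv', h₁', h₂']
  have hP : ∀ v₀, ∃ P : Fin (quadBound n t (Sum.inr x) v₀) ≃
      Fin (quadBound n t m' (vmap χ.k χ.π v₀)),
      finSign P = ∏ w with M w = v₀, finSign (φ.ρ w) ∧
      ∀ h : {f : Γ.E // f ≠ e} × Bool, M (Γ.ep h.1.1 h.2) = v₀ →
        ∀ hlt : indCmpInt Γ e uu vv h.1.1 h.2 < quadBound n t (Sum.inr x) v₀,
        (P ⟨indCmpInt Γ e uu vv h.1.1 h.2, hlt⟩ : Fin _).val =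
          indCmpInt Γ' (φ.ψ e) uu' vv' (φ.ψ h.1.1) (xor (φ.fl h.1.1) h.2) := by
    rintro (i | y)
    · have hb : quadBound n t (Sum.inr x) (Sum.inl i) = 1 := quadBound_of_ne (by simp)
      have hb' : quadBound n t m' (vmap χ.k χ.π (Sum.inl i)) = 1 :=
        quadBound_of_ne fun h => Sum.inl_ne_inr (h.trans hm')
      refine ⟨finCongr (hb.trans hb'.symm), ?_, fun h hh hlt => ?_⟩
      · rw [finSign_finCongr, φ.prod_fiber_external M _ (by simp [M])]
      · rcases hw : Γ.ep h.1.1 h.2 with j | y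
        · have hj : Γ'.ep (φ.ψ h.1.1) (xor (φ.fl h.1.1) h.2) = Sum.inl (j + φ.k) := by
            rw [φ.ep_map, hw]
            rfl
          rw [hind' _ _ (by simp [hw]) (by simp [hw]), BDiag.cmp_eq_zero hj]
          simp only [hind _ _ (show Γ.ep h.1.1 h.2 ≠ Sum.inr uu by simp [hw]) (by simp [hw])]
          simp [BDiag.cmp_eq_zero hw]
        · simp [hw, M] at hh
    by_cases hy : y = x
    · subst hy
      have hb : quadBound n t (Sum.inr y) (Sum.inr y) = 4 := quadBound_internal rfl rfl
      have hb' : quadBound n t m' (vmap χ.k χ.π (Sum.inr y)) = 4 :=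
        quadBound_internal hm' hm'.symm
      obtain ⟨P, hPs, hP⟩ := exists_perm_four (φ.fl e)
        (finSign (φ.ρ (Sum.inr uu))) (finSign (φ.ρ (Sum.inr vv)))
      have hfib : ∀ w, M w = Sum.inr y ↔ w = Sum.inr uu ∨ w = Sum.inr vv := by
        rintro (i | a)
        · simp [M]
        · simp only [M, Sum.map_inr, Sum.inr.injEq]
          constructor
          · intro ha
            by_cases hav : a = vv
            · exact Or.inr hav
            · exact Or.inl (hinj a uu hav hne (ha.trans hμu.symm))
          · rintro (rfl | rfl) <;> assumption
      refine ⟨((finCongr hb).trans P).trans (finCongr hb'.symm), ?_, fun h hh hlt => ?_⟩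
      · rw [finSign_finCongr_trans, hPs, ← Finset.prod_pair (f := fun w => finSign (φ.ρ w))
          (by simpa using hne)]
        exact Finset.prod_congr (by ext w; simp [hfib]) fun _ _ => rfl
      · obtain ⟨⟨f, hf⟩, d⟩ := h
        change (P ⟨indCmpInt Γ e uu vv f d, _⟩ : ℕ) = _
        have hepu : Γ'.ep (φ.ψ f) (xor (φ.fl f) d) = vmap φ.k φ.π (Γ.ep f d) := φ.ep_map f d
        have hne' : φ.π uu ≠ φ.π vv := φ.π.injective.ne hne
        rcases (hfib (Γ.ep f d)).mp hh with hw | hw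
        · obtain ⟨r, hr, hr₁, hr₂⟩ := φ.cyclicOffset hu hw hf
          rw [hw] at hepu
          have h₁ : indCmpInt Γ e uu vv f d = r - 1 := by simp [indCmpInt, hw, hr₁]
          rw [(hP r _ hr).1 h₁]
          rcases hcase with ⟨hfl, hu', hv'⟩ | ⟨hfl, hu', hv'⟩ <;>
            simp only [hfl, Bool.xor_false] at hr₂ <;>
            simp [indCmpInt, hu', hv', hepu, vmap, hfl, hne', hr₂]
        · obtain ⟨r, hr, hr₁, hr₂⟩ := φ.cyclicOffset hv hw hf
          rw [hw] at hepu
          have h₁ : indCmpInt Γ e uu vv f d = r + 1 := by simp [indCmpInt, hw, hr₁, hne.symm]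
          rw [(hP r _ hr).2 h₁]
          rcases hcase with ⟨hfl, hu', hv'⟩ | ⟨hfl, hu', hv'⟩ <;>
            simp only [hfl, Bool.xor_true, Bool.not_true, Bool.not_false] at hr₂ <;>
            simp [indCmpInt, hu', hv', hepu, vmap, hfl, hne'.symm, hr₂]
    · have hyx : (Sum.inr y : Fin n ⊕ Fin t) ≠ Sum.inr x := by simpa using hy
      obtain ⟨P, hPs, hP⟩ := φ.exists_slotEquiv M (Sum.inr y) (by simp [M])
        (by
          simp only [M, Sum.map_inr, Sum.inr.injEq]
          intro a a' ha ha'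
          refine hinj a a' ?_ ?_ (ha.trans ha'.symm)
          · rintro rfl; exact hy (ha.symm.trans hμv)
          · rintro rfl; exact hy (ha'.symm.trans hμv))
        (show quadBound n t (Sum.inr x) (Sum.inr y) = 3 from quadBound_of_ne hyx)
        (show quadBound n t m' (vmap χ.k χ.π (Sum.inr y)) = 3 from
          quadBound_of_ne fun h => hyx ((vmap_bijective _ _).injective (h.trans hm')))
      refine ⟨P, hPs, fun h hh hlt => ?_⟩
      have h₁ : Γ.ep h.1.1 h.2 ≠ Sum.inr uu := by
        intro hw
        rw [hw] at hh
        simp only [M, Sum.map_inr, Sum.inr.injEq] at hh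
        exact hy (hh.symm.trans hμu)
      have h₂ : Γ.ep h.1.1 h.2 ≠ Sum.inr vv := by
        intro hw
        rw [hw] at hh
        simp only [M, Sum.map_inr, Sum.inr.injEq] at hh
        exact hy (hh.symm.trans hμv)
      rw [hind' _ _ h₁ h₂]
      simp only [hind _ _ h₁ h₂] at hlt ⊢
      exact hP _ _ hh hlt
  obtain ⟨ρ', hρ', hcmp'⟩ := exists_transported_reordering (vmap_bijective χ.k χ.π)
    ρ hsgn (fun h : {f : Γ.E // f ≠ e} × Bool => hcmp h.1 h.2) χ.ρ
    (fun h => χ.cmp_map_exists (hep h.1 h.2)) hP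
    ((Finset.prod_fiberwise _ M _).trans hsign)
  obtain ⟨g', hg'⟩ := exists_flip φ.ψ e φ.fl fun f => xor (χ.fl (φE f)) (g f)
  refine ⟨{
    uu := uu'
    vv := vv'
    hu := ?_
    hv := ?_
    hne := ?_
    x := χ.π x
    hm := hm'
    μ := μ'
    hμu := ?_
    hμv := ?_
    hinj := ?_
    hsurj := χ.π.surjective.comp (hsurj.comp φ.π.symm.surjective)
    k := k'
    φE := ((edgesNe φ.ψ e).symm.trans φE).trans χ.ψ
    g := g'
    hep := ?_
    ρ := ρ'
    hsgn := hρ'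
    hcmp := ?_ }⟩
  · rcases hcase with ⟨hfl, hu', -⟩ | ⟨hfl, hu', -⟩
    · simpa [hfl, hu, hu', vmap] using φ.ep_map e false
    · simpa [hfl, hv, hu', vmap] using φ.ep_map e true
  · rcases hcase with ⟨hfl, -, hv'⟩ | ⟨hfl, -, hv'⟩
    · simpa [hfl, hv, hv', vmap] using φ.ep_map e true
    · simpa [hfl, hu, hv', vmap] using φ.ep_map e false
  · rcases hcase with ⟨-, hu', hv'⟩ | ⟨-, hu', hv'⟩ <;> simp [hu', hv', hne, hne.symm]
  · rcases hcase with ⟨-, hu', -⟩ | ⟨-, hu', -⟩ <;> simp [hu', μ', hμu, hμv]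
  · rcases hcase with ⟨-, -, hv'⟩ | ⟨-, -, hv'⟩ <;> simp [hv', μ', hμu, hμv]
  · have hinj' : ∀ a b, μ a = μ b → a = b ∨ a = uu ∧ b = vv ∨ a = vv ∧ b = uu := by
      intro a b hab
      by_cases ha : a = vv <;> by_cases hb : b = vv
      · exact Or.inl (ha.trans hb.symm)
      · exact Or.inr (Or.inr ⟨ha, hinj b uu hb hne (by rw [← hab, ha, hμv, hμu])⟩)
      · exact Or.inr (Or.inl ⟨hinj a uu ha hne (by rw [hab, hb, hμv, hμu]), hb⟩)
      · exact Or.inl (hinj a b ha hb hab)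
    intro a b ha hb hab
    obtain ⟨a, rfl⟩ := φ.π.surjective a
    obtain ⟨b, rfl⟩ := φ.π.surjective b
    have hab' : μ a = μ b := by simpa [μ'] using hab
    rcases hinj' a b hab' with h | ⟨rfl, rfl⟩ | ⟨rfl, rfl⟩
    · rw [h]
    · rcases hcase with ⟨-, -, hv'⟩ | ⟨-, -, hv'⟩
      exacts [absurd hv'.symm hb, absurd hv'.symm ha]
    · rcases hcase with ⟨-, -, hv'⟩ | ⟨-, -, hv'⟩
      exacts [absurd hv'.symm ha, absurd hv'.symm hb]
  · rintro ⟨f, hf⟩ b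
    obtain ⟨f, d, rfl, rfl⟩ := φ.exists_end f b
    have hf' : f ≠ e := fun h => hf (congrArg φ.ψ h)
    simp only [Equiv.trans_apply, edgesNe_symm_apply, hg' f hf', φ.ep_map, hM', Bool.xor_assoc,
      χ.ep_map]
    exact congrArg _ (hep ⟨f, hf'⟩ d)
  · rintro ⟨f, hf⟩ b
    obtain ⟨f, d, rfl, rfl⟩ := φ.exists_end f b
    have hf' : f ≠ e := fun h => hf (congrArg φ.ψ h)
    refine exists_position_congr ρ' ?_ ?_ (hcmp' (⟨f, hf'⟩, d))
    · simp only [φ.ep_map, hM', M]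
    · simp only [Equiv.trans_apply, edgesNe_symm_apply, hg' f hf', Bool.xor_assoc]

theorem CollapseMix.transport {m m' : Fin n ⊕ Fin t} {Γ Γ' : Tri n (t+1)} {e : Γ.E}
    {Δ : BDiag n t (quadBound n t m)} {Δ' : BDiag n t (quadBound n t m')}
    (c : CollapseMix Γ e Δ) (φ : BIso Γ Γ') (χ : BIso Δ Δ') (hsign : φ.sign = χ.sign) :
    Nonempty (CollapseMix Γ' (φ.ψ e) Δ') := by
  have : NeZero n := ⟨Γ.npos.ne'⟩
  obtain ⟨be, iu, vv, hu, hv, x, k, hx, rfl, μ, hinj, hsurj, φE, g, hep, ρ, hsgn, hcmp⟩ := c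
  have hm' := χ.quad_vertex
  let M : Fin n ⊕ Fin (t+1) → Fin n ⊕ Fin t := vmapMix k μ vv x
  let k' : Fin n := k + χ.k - φ.k
  let μ' : Fin (t+1) → Fin t := fun a => χ.π (μ (φ.π.symm a))
  have hMvv : M (Sum.inr vv) = Sum.inl x := by simp [M, vmapMix]
  have hMinl : ∀ i, M (Sum.inl i) = Sum.inl (i + k) := fun i => by simp [M, vmapMix]
  have hMinr : ∀ y, y ≠ vv → M (Sum.inr y) = Sum.inr (μ y) := fun y hy => by
    simp [M, vmapMix, hy]
  have hM' : ∀ w, vmapMix k' μ' (φ.π vv) (x + χ.k) (vmap φ.k φ.π w) = vmap χ.k χ.π (M w) := by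
    rintro (i | y)
    · simp only [vmap, vmapMix, M, k', Sum.map_inl, reduceCtorEq, if_false]
      congr 1
      abel
    · by_cases hy : y = vv
      · simp [hy, vmap, vmapMix, M]
      · simp [hy, vmap, vmapMix, M, μ']
  have hbe : (!(xor (φ.fl e) be)) = xor (φ.fl e) (!be) := by simp
  -- positions of the ends away from the internal endpoint of the collapsed edge
  have hind : ∀ f d, Γ.ep f d ≠ Sum.inr vv → indCmpMix Γ e be vv f d = Γ.cmp f d :=
    fun f d h => by simp [indCmpMix, h]
  have hind' : ∀ f d, Γ.ep f d ≠ Sum.inr vv →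
      indCmpMix Γ' (φ.ψ e) (xor (φ.fl e) be) (φ.π vv) (φ.ψ f) (xor (φ.fl f) d) =
        Γ'.cmp (φ.ψ f) (xor (φ.fl f) d) := fun f d h => by
    have h' : Γ'.ep (φ.ψ f) (xor (φ.fl f) d) ≠ Sum.inr (φ.π vv) := fun hw =>
      h ((vmap_bijective φ.k φ.π).injective ((φ.ep_map f d).symm.trans hw))
    simp [indCmpMix, h']
  have hP : ∀ v₀, ∃ P : Fin (quadBound n t (Sum.inl x) v₀) ≃
      Fin (quadBound n t m' (vmap χ.k χ.π v₀)),
      finSign P = ∏ w with M w = v₀, finSign (φ.ρ w) ∧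
      ∀ h : {f : Γ.E // f ≠ e} × Bool, M (Γ.ep h.1.1 h.2) = v₀ →
        ∀ hlt : indCmpMix Γ e be vv h.1.1 h.2 < quadBound n t (Sum.inl x) v₀,
        (P ⟨indCmpMix Γ e be vv h.1.1 h.2, hlt⟩ : Fin _).val =
          indCmpMix Γ' (φ.ψ e) (xor (φ.fl e) be) (φ.π vv) (φ.ψ h.1.1)
            (xor (φ.fl h.1.1) h.2) := by
    rintro (i | y)
    · by_cases hi : i = x
      · subst hi
        have hb : quadBound n t (Sum.inl i) (Sum.inl i) = 2 := quadBound_external rfl rfl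
        have hb' : quadBound n t m' (vmap χ.k χ.π (Sum.inl i)) = 2 :=
          quadBound_external hm' hm'.symm
        obtain ⟨P, hPs, hP⟩ := exists_perm_two (finSign (φ.ρ (Sum.inr vv)))
        refine ⟨((finCongr hb).trans P).trans (finCongr hb'.symm), ?_, fun h hh hlt => ?_⟩
        · rw [finSign_finCongr_trans, hPs, Finset.prod_eq_single (Sum.inr vv)]
          · rintro (j | y) hw hne
            · exact φ.finSign_ρ_inl j
            · have hy : y ≠ vv := fun h => hne (congrArg Sum.inr h)
              simp [hMinr y hy] at hw
          · exact fun h => (h (by simp [hMvv])).elim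
        · obtain ⟨⟨f, hf⟩, d⟩ := h
          change (P ⟨indCmpMix Γ e be vv f d, _⟩ : ℕ) = _
          have hw : Γ.ep f d = Sum.inr vv := by
            change M (Γ.ep f d) = _ at hh
            rcases hw : Γ.ep f d with j | y
            · rw [hw, hMinl, Sum.inl.injEq, ← hx, add_left_inj] at hh
              subst hh
              exact absurd (Γ.eq_of_ep_eq_of_cmp_eq (hw.trans hu.symm)
                ((BDiag.cmp_eq_zero hw).trans (BDiag.cmp_eq_zero hu).symm)) hf
            · by_contra hne
              rw [hw, hMinr y fun h => hne (congrArg Sum.inr h)] at hh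
              exact Sum.inr_ne_inl hh
          obtain ⟨r, hr, hr₁, hr₂⟩ := φ.cyclicOffset hv hw hf
          have hepu := φ.ep_map f d
          rw [hw] at hepu
          have h₁ : indCmpMix Γ e be vv f d = r - 1 := by simp [indCmpMix, hw, hr₁]
          rw [hP r _ hr h₁]
          simp only [indCmpMix, hepu, hbe, hr₂, vmap, Sum.map_inr, if_true]
      · have hix : (Sum.inl i : Fin n ⊕ Fin t) ≠ Sum.inl x := by simpa using hi
        have hb : quadBound n t (Sum.inl x) (Sum.inl i) = 1 := quadBound_of_ne hix
        have hb' : quadBound n t m' (vmap χ.k χ.π (Sum.inl i)) = 1 :=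
          quadBound_of_ne fun h => hix ((vmap_bijective _ _).injective (h.trans hm'))
        have hfib : ∀ y, M (Sum.inr y) ≠ Sum.inl i := by
          intro y
          by_cases hy : y = vv
          · rw [hy, hMvv]
            exact hix.symm
          · simp [hMinr y hy]
        refine ⟨finCongr (hb.trans hb'.symm), ?_, fun h hh hlt => ?_⟩
        · rw [finSign_finCongr, φ.prod_fiber_external M _ hfib]
        · rcases hw : Γ.ep h.1.1 h.2 with j | y
          · have hj : Γ'.ep (φ.ψ h.1.1) (xor (φ.fl h.1.1) h.2) = Sum.inl (j + φ.k) := by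
              rw [φ.ep_map, hw]
              rfl
            rw [hind' _ _ (by simp [hw]), BDiag.cmp_eq_zero hj]
            simp only [hind _ _ (show Γ.ep h.1.1 h.2 ≠ Sum.inr vv by simp [hw])]
            simp [BDiag.cmp_eq_zero hw]
          · exact absurd (hw ▸ hh) (hfib y)
    · have hyx : (Sum.inr y : Fin n ⊕ Fin t) ≠ Sum.inl x := by simp
      have hvv : ∀ w, M w = Sum.inr y → w ≠ Sum.inr vv := by
        rintro w hw rfl
        exact Sum.inl_ne_inr (hMvv.symm.trans hw)
      obtain ⟨P, hPs, hP⟩ := φ.exists_slotEquiv M (Sum.inr y) (by simp [hMinl])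
        (by
          intro a a' ha ha'
          have hav : a ≠ vv := fun h => hvv _ ha (congrArg Sum.inr h)
          have hav' : a' ≠ vv := fun h => hvv _ ha' (congrArg Sum.inr h)
          refine hinj a a' hav hav' (Sum.inr_injective (α := Fin n) ?_)
          exact (hMinr a hav).symm.trans (ha.trans (ha'.symm.trans (hMinr a' hav'))))
        (show quadBound n t (Sum.inl x) (Sum.inr y) = 3 from quadBound_of_ne hyx)
        (show quadBound n t m' (vmap χ.k χ.π (Sum.inr y)) = 3 from
          quadBound_of_ne fun h => hyx ((vmap_bijective _ _).injective (h.trans hm')))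
      refine ⟨P, hPs, fun h hh hlt => ?_⟩
      have hw := hvv _ hh
      rw [hind' _ _ hw]
      simp only [hind _ _ hw] at hlt ⊢
      exact hP _ _ hh hlt
  obtain ⟨ρ', hρ', hcmp'⟩ := exists_transported_reordering (vmap_bijective χ.k χ.π)
    ρ hsgn (fun h : {f : Γ.E // f ≠ e} × Bool => hcmp h.1 h.2) χ.ρ
    (fun h => χ.cmp_map_exists (hep h.1 h.2)) hP
    ((Finset.prod_fiberwise _ M _).trans hsign)
  obtain ⟨g', hg'⟩ := exists_flip φ.ψ e φ.fl fun f => xor (χ.fl (φE f)) (g f)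
  refine ⟨{
    be := xor (φ.fl e) be
    iu := iu + φ.k
    vv := φ.π vv
    hu := by rw [φ.ep_map, hu]; rfl
    hv := by rw [hbe, φ.ep_map, hv]; rfl
    x := x + χ.k
    k := k'
    hx := by simp only [k', ← hx]; abel
    hm := hm'
    μ := μ'
    hinj := ?_
    hsurj := χ.π.surjective.comp (hsurj.comp φ.π.symm.surjective)
    φE := ((edgesNe φ.ψ e).symm.trans φE).trans χ.ψ
    g := g'
    hep := ?_
    ρ := ρ'
    hsgn := hρ'
    hcmp := ?_ }⟩
  · intro a b ha hb hab
    refine φ.π.symm.injective (hinj _ _ ?_ ?_ (χ.π.injective hab))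
    · rwa [Ne, Equiv.symm_apply_eq]
    · rwa [Ne, Equiv.symm_apply_eq]
  · rintro ⟨f, hf⟩ b
    obtain ⟨f, d, rfl, rfl⟩ := φ.exists_end f b
    have hf' : f ≠ e := fun h => hf (congrArg φ.ψ h)
    simp only [Equiv.trans_apply, edgesNe_symm_apply, hg' f hf', φ.ep_map, hM', Bool.xor_assoc,
      χ.ep_map]
    exact congrArg _ (hep ⟨f, hf'⟩ d)
  · rintro ⟨f, hf⟩ b
    obtain ⟨f, d, rfl, rfl⟩ := φ.exists_end f b
    have hf' : f ≠ e := fun h => hf (congrArg φ.ψ h)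
    refine exists_position_congr ρ' ?_ ?_ (hcmp' (⟨f, hf'⟩, d))
    · simp only [φ.ep_map, hM', M]
    · simp only [Equiv.trans_apply, edgesNe_symm_apply, hg' f hf', Bool.xor_assoc]

theorem CollapseWil.transport {m m' : Fin n ⊕ Fin t} {Γ Γ' : Tri (n+1) t} {i₀ : Fin (n+1)}
    {Δ : BDiag n t (quadBound n t m)} {Δ' : BDiag n t (quadBound n t m')}
    (c : CollapseWil Γ i₀ Δ) (φ : BIso Γ Γ') (χ : BIso Δ Δ') (hπ : φ.π = χ.π)
    (hsign : φ.sign = χ.sign) : Nonempty (CollapseWil Γ' (i₀ + φ.k) Δ') := by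
  have : NeZero n := ⟨Δ.npos.ne'⟩
  obtain ⟨x, rfl, ν, hν0, hν1, hνsucc, φE, g, hep, ρ, hsgn, hcmp⟩ := c
  have hm' := χ.quad_vertex
  let M : Fin (n+1) ⊕ Fin t → Fin n ⊕ Fin t := Sum.map ν id
  let ν' : Fin (n+1) → Fin n := fun a => ν (a - φ.k) + χ.k
  have hM' : ∀ w, Sum.map ν' id (vmap φ.k φ.π w) = vmap χ.k χ.π (M w) := by
    rintro (i | y) <;> simp [ν', M, vmap, hπ]
  have hext : ∀ f d j, Γ.ep f d = Sum.inl j →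
      indCmpWil Γ' (i₀ + φ.k) (φ.ψ f) (xor (φ.fl f) d) = indCmpWil Γ i₀ f d := by
    intro f d j hj
    have hj' : Γ'.ep (φ.ψ f) (xor (φ.fl f) d) = Sum.inl (j + φ.k) := by
      rw [φ.ep_map, hj]
      rfl
    simp only [indCmpWil, hj, hj', BDiag.cmp_eq_zero hj, BDiag.cmp_eq_zero hj', Sum.inl.injEq,
      add_right_comm i₀ φ.k 1, add_left_inj]
  have hint : ∀ f d y, Γ.ep f d = Sum.inr y → indCmpWil Γ i₀ f d = Γ.cmp f d :=
    fun f d y hy => by simp [indCmpWil, hy]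
  have hint' : ∀ f d y, Γ.ep f d = Sum.inr y →
      indCmpWil Γ' (i₀ + φ.k) (φ.ψ f) (xor (φ.fl f) d) = Γ'.cmp (φ.ψ f) (xor (φ.fl f) d) :=
    fun f d y hy => by
      have hy' : Γ'.ep (φ.ψ f) (xor (φ.fl f) d) = Sum.inr (φ.π y) := by
        rw [φ.ep_map, hy]
        rfl
      simp [indCmpWil, hy']
  have hP : ∀ v₀, ∃ P : Fin (quadBound n t (Sum.inl x) v₀) ≃
      Fin (quadBound n t m' (vmap χ.k χ.π v₀)),
      finSign P = ∏ w with M w = v₀, finSign (φ.ρ w) ∧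
      ∀ h : Γ.E × Bool, M (Γ.ep h.1 h.2) = v₀ →
        ∀ hlt : indCmpWil Γ i₀ h.1 h.2 < quadBound n t (Sum.inl x) v₀,
        (P ⟨indCmpWil Γ i₀ h.1 h.2, hlt⟩ : Fin _).val =
          indCmpWil Γ' (i₀ + φ.k) (φ.ψ h.1) (xor (φ.fl h.1) h.2) := by
    rintro (i | y)
    · have hb : quadBound n t (Sum.inl x) (Sum.inl i) =
          quadBound n t m' (vmap χ.k χ.π (Sum.inl i)) := by
        simpa using Fintype.card_congr (χ.ρ (Sum.inl i))
      refine ⟨finCongr hb, ?_, fun h hh hlt => ?_⟩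
      · rw [finSign_finCongr, φ.prod_fiber_external M _ (by simp [M])]
      · rcases hw : Γ.ep h.1 h.2 with j | y
        · exact (hext _ _ j hw).symm
        · simp [M, hw] at hh
    · have hyx : (Sum.inr y : Fin n ⊕ Fin t) ≠ Sum.inl x := by simp
      obtain ⟨P, hPs, hP⟩ := φ.exists_slotEquiv M (Sum.inr y) (by simp [M])
        (fun a a' ha ha' => Sum.inr_injective (α := Fin n) (ha.trans ha'.symm))
        (show quadBound n t (Sum.inl x) (Sum.inr y) = 3 from quadBound_of_ne hyx)
        (show quadBound n t m' (vmap χ.k χ.π (Sum.inr y)) = 3 from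
          quadBound_of_ne fun h => hyx ((vmap_bijective _ _).injective (h.trans hm')))
      refine ⟨P, hPs, fun h hh hlt => ?_⟩
      rcases hw : Γ.ep h.1 h.2 with j | z
      · simp [M, hw] at hh
      · rw [hint' _ _ z hw]
        simp only [hint _ _ z hw] at hlt ⊢
        exact hP _ _ hh hlt
  obtain ⟨ρ', hρ', hcmp'⟩ := exists_transported_reordering (vmap_bijective χ.k χ.π)
    ρ hsgn (fun h : Γ.E × Bool => hcmp h.1 h.2) χ.ρ
    (fun h => χ.cmp_map_exists (hep h.1 h.2)) hP
    ((Finset.prod_fiberwise _ M _).trans hsign)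
  let g' : Γ'.E → Bool := fun f =>
    xor (xor (χ.fl (φE (φ.ψ.symm f))) (g (φ.ψ.symm f))) (φ.fl (φ.ψ.symm f))
  have hg' : ∀ f b, xor (g' (φ.ψ f)) (xor (φ.fl f) b) = xor (xor (χ.fl (φE f)) (g f)) b :=
    fun f b => by simp [g']
  refine ⟨{
    x := x + χ.k
    hm := hm'
    ν := ν'
    hν0 := by simp [ν', hν0]
    hν1 := by simp [ν', add_right_comm i₀ φ.k 1, hν1]
    hνsucc := ?_
    φE := (φ.ψ.symm.trans φE).trans χ.ψ
    g := g'
    hep := ?_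
    ρ := ρ'
    hsgn := hρ'
    hcmp := ?_ }⟩
  · intro a ha
    have h := hνsucc (a - φ.k) fun h => ha (sub_eq_iff_eq_add.mp h)
    simp only [ν', add_sub_right_comm a 1 φ.k, Fin.val_add, h, Nat.mod_add_mod]
    rw [add_right_comm]
  · intro f b
    obtain ⟨f, d, rfl, rfl⟩ := φ.exists_end f b
    simp only [Equiv.trans_apply, Equiv.symm_apply_apply, hg', φ.ep_map, hM', Bool.xor_assoc,
      χ.ep_map]
    exact congrArg _ (hep f d)
  · intro f b
    obtain ⟨f, d, rfl, rfl⟩ := φ.exists_end f b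
    refine exists_position_congr ρ' ?_ ?_ (hcmp' (f, d))
    · simp only [φ.ep_map, hM', M]
    · simp only [Equiv.trans_apply, Equiv.symm_apply_apply, hg', Bool.xor_assoc]

end Transport

/-! ### Collapses of pairs up to equivalence -/

theorem triBound_relabel {n t : ℕ} (π : Equiv.Perm (Fin t)) (v : Fin n ⊕ Fin t) :
    triBound n t (Sum.map id π v) = triBound n t v := by
  rcases v with i | y <;> rfl

theorem quadBound_relabel {n t : ℕ} (m : Fin n ⊕ Fin t) (π : Equiv.Perm (Fin t))
    (v : Fin n ⊕ Fin t) :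
    quadBound n t (Sum.map id π m) (Sum.map id π v) = quadBound n t m v := by
  rcases m with i | y <;> rcases v with j | z <;> simp [quadBound, triBound]

theorem two_le_quadBound {n t : ℕ} (m : Fin n ⊕ Fin t) : 2 ≤ quadBound n t m m := by
  rcases m with x | x
  · rw [quadBound_external rfl rfl]
  · rw [quadBound_internal rfl rfl]
    norm_num

theorem PairEquivSg.symm {ε : ℤˣ} {P P' : SPair} (h : PairEquivSg ε P P') :
    PairEquivSg ε P' P := by
  obtain ⟨p, Γ, a⟩ := P
  obtain ⟨p', Γ', a'⟩ := P'
  obtain ⟨h, φ, hφ, ha⟩ := h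
  obtain rfl : p = p' := h
  change BIso Γ Γ' at φ
  change Sum.map φ.ψ (· + φ.k) a = a' at ha
  have : NeZero p.1 := ⟨Γ.npos.ne'⟩
  obtain ⟨ω, hω, hψ, hk⟩ := φ.exists_symm
  refine ⟨rfl, ω, hω.trans hφ, ?_⟩
  change Sum.map ω.ψ (· + ω.k) a' = a
  rw [← ha, hψ, hk]
  rcases a with e | i <;> simp

theorem PairEquivSg.trans {ε ε' : ℤˣ} {P P' P'' : SPair} (h : PairEquivSg ε P P')
    (h' : PairEquivSg ε' P' P'') : PairEquivSg (ε * ε') P P'' := by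
  obtain ⟨p, Γ, a⟩ := P
  obtain ⟨p', Γ', a'⟩ := P'
  obtain ⟨p'', Γ'', a''⟩ := P''
  obtain ⟨h, φ, hφ, ha⟩ := h
  obtain ⟨h', φ', hφ', ha'⟩ := h'
  obtain rfl : p = p' := h
  obtain rfl : p = p'' := h'
  change BIso Γ Γ' at φ
  change BIso Γ' Γ'' at φ'
  change Sum.map φ.ψ (· + φ.k) a = a' at ha
  change Sum.map φ'.ψ (· + φ'.k) a' = a'' at ha'
  have : NeZero p.1 := ⟨Γ.npos.ne'⟩
  obtain ⟨ω, hω, hψ, hk⟩ := φ.exists_trans φ'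
  refine ⟨rfl, ω, hω.trans (congrArg₂ _ hφ hφ'), ?_⟩
  change Sum.map ω.ψ (· + ω.k) a = a''
  rw [← ha', ← ha, hψ, hk]
  rcases a with e | i <;> simp [add_assoc]

theorem QIsoSg.symm {ε : ℤˣ} {Q Q' : QuadS} (h : QIsoSg ε Q Q') : QIsoSg ε Q' Q := by
  obtain ⟨q, m, Δ⟩ := Q
  obtain ⟨q', m', Δ'⟩ := Q'
  obtain ⟨h, χ, hχ⟩ := h
  obtain rfl : q = q' := h
  change BIso Δ Δ' at χ
  obtain ⟨ω, hω, -, -⟩ := χ.exists_symm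
  exact ⟨rfl, ω, hω.trans hχ⟩

/-- An isomorphism of collapsed diagrams lifts to an equivalence of the pairs they come from. -/
theorem CollPair.exists_pairEquivSg {ε : ℤˣ} {P : SPair} {Q Q' : QuadS} (hP : 0 < P.1.2)
    (hc : CollPair P Q) (hQ : QIsoSg ε Q Q') :
    ∃ P', PairEquivSg ε P P' ∧ CollPair P' Q' := by
  obtain ⟨p, Γ, a⟩ := P
  obtain ⟨⟨n, t⟩, m, Δ⟩ := Q
  obtain ⟨q', m', Δ'⟩ := Q'
  obtain ⟨h, χ, hχ⟩ := hQ
  obtain rfl : (n, t) = q' := h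
  change BIso Δ Δ' at χ
  have hbd : 2 ≤ triBound p.1 p.2 (Sum.inr ⟨0, hP⟩) := by simp [triBound]
  rcases hc with ⟨h, hc⟩ | ⟨h, hc⟩
  · obtain rfl : p = (n, t + 1) := h
    obtain ⟨Γ', φ, hφ, -⟩ := Γ.exists_relabel (Equiv.refl _) (triBound_relabel _) _ hbd ε
    rcases a with e | i
    · refine ⟨⟨_, Γ', Sum.inl (φ.ψ e)⟩, ⟨rfl, φ, hφ, rfl⟩, Or.inl ⟨rfl, ?_⟩⟩
      change Nonempty (CollapseInt Γ e Δ) ∨ Nonempty (CollapseMix Γ e Δ) at hc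
      change Nonempty (CollapseInt Γ' (φ.ψ e) Δ') ∨ Nonempty (CollapseMix Γ' (φ.ψ e) Δ')
      exact hc.imp (fun ⟨c⟩ => c.transport φ χ (hφ.trans hχ.symm))
        fun ⟨c⟩ => c.transport φ χ (hφ.trans hχ.symm)
    · exact hc.elim
  · obtain rfl : p = (n + 1, t) := h
    obtain ⟨Γ', φ, hφ, hπ⟩ := Γ.exists_relabel χ.π (triBound_relabel _) _ hbd ε
    rcases a with e | i
    · exact hc.elim
    · refine ⟨⟨_, Γ', Sum.inr (i + φ.k)⟩, ⟨rfl, φ, hφ, rfl⟩, Or.inr ⟨rfl, ?_⟩⟩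
      obtain ⟨c⟩ : Nonempty (CollapseWil Γ i Δ) := hc
      exact c.transport φ χ hπ (hφ.trans hχ.symm)

/-- An equivalence of pairs descends to an isomorphism of the collapsed diagrams. -/
theorem CollPair.exists_qIsoSg {ε : ℤˣ} {P P' : SPair} {Q : QuadS}
    (hc : CollPair P Q) (hP : PairEquivSg ε P P') :
    ∃ Q', QIsoSg ε Q Q' ∧ CollPair P' Q' := by
  obtain ⟨p, Γ, a⟩ := P
  obtain ⟨p', Γ', a'⟩ := P'
  obtain ⟨⟨n, t⟩, m, Δ⟩ := Q
  obtain ⟨h, φ, hφ, ha⟩ := hP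
  obtain rfl : p = p' := h
  change BIso Γ Γ' at φ
  change Sum.map φ.ψ (· + φ.k) a = a' at ha
  subst ha
  rcases hc with ⟨h, hc⟩ | ⟨h, hc⟩
  · obtain rfl : p = (n, t + 1) := h
    obtain ⟨Δ', χ, hχ, -⟩ :=
      Δ.exists_relabel (Equiv.refl _) (quadBound_relabel m _) m (two_le_quadBound m) ε
    rcases a with e | i
    · refine ⟨⟨_, _, Δ'⟩, ⟨rfl, χ, hχ⟩, Or.inl ⟨rfl, ?_⟩⟩
      change Nonempty (CollapseInt Γ e Δ) ∨ Nonempty (CollapseMix Γ e Δ) at hc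
      change Nonempty (CollapseInt Γ' (φ.ψ e) Δ') ∨ Nonempty (CollapseMix Γ' (φ.ψ e) Δ')
      exact hc.imp (fun ⟨c⟩ => c.transport φ χ (hφ.trans hχ.symm))
        fun ⟨c⟩ => c.transport φ χ (hφ.trans hχ.symm)
    · exact hc.elim
  · obtain rfl : p = (n + 1, t) := h
    obtain ⟨Δ', χ, hχ, hπ⟩ :=
      Δ.exists_relabel φ.π (quadBound_relabel m _) m (two_le_quadBound m) ε
    rcases a with e | i
    · exact hc.elim
    · refine ⟨⟨_, _, Δ'⟩, ⟨rfl, χ, hχ⟩, Or.inr ⟨rfl, ?_⟩⟩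
      obtain ⟨c⟩ : Nonempty (CollapseWil Γ i Δ) := hc
      exact c.transport φ χ hπ.symm (hφ.trans hχ.symm)

theorem CollPairT.collPair {τ : LiftTy} {P : SPair} {Q : QuadS} (h : CollPairT τ P Q) :
    CollPair P Q := by
  obtain ⟨p, Γ, a⟩ := P
  rcases τ with S | w | u
  · obtain ⟨h, hc⟩ := h
    obtain rfl : p = _ := h
    rcases a with e | i
    · obtain ⟨c, -⟩ : CollapseIntT S Γ e Q.2.2 := hc
      exact Or.inl ⟨rfl, Or.inl ⟨c⟩⟩
    · exact hc.elim
  · obtain ⟨h, hc⟩ := h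
    obtain rfl : p = _ := h
    rcases a with e | i
    · exact hc.elim
    · obtain ⟨c, -⟩ : CollapseWilT w Γ i Q.2.2 := hc
      exact Or.inr ⟨rfl, ⟨c⟩⟩
  · obtain ⟨h, hc⟩ := h
    obtain rfl : p = _ := h
    rcases a with e | i
    · exact Or.inl ⟨rfl, Or.inr hc⟩
    · exact hc.elim

/-- In the absence of internal vertices only Wilson edges can be split off. -/
theorem CollPairT.eq_wilson {τ : LiftTy} {P : SPair} {Q : QuadS} (h : CollPairT τ P Q)
    (hQ : Q.1.2 = 0) : ∃ w : Bool, τ = Sum.inr (Sum.inl w) := by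
  have : IsEmpty (Fin Q.1.2) := hQ ▸ Fin.isEmpty
  obtain ⟨p, Γ, a⟩ := P
  rcases τ with S | w | u
  · obtain ⟨h, hc⟩ := h
    obtain rfl : p = _ := h
    rcases a with e | i
    · obtain ⟨c, -⟩ : CollapseIntT S Γ e Q.2.2 := hc
      exact isEmptyElim c.x
    · exact hc.elim
  · exact ⟨w, rfl⟩
  · obtain ⟨h, hc⟩ := h
    obtain rfl : p = _ := h
    rcases a with e | i
    · obtain ⟨c⟩ : Nonempty (CollapseMix Γ e Q.2.2) := hc
      exact isEmptyElim (c.μ 0)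
    · exact hc.elim

/-- A diagram with three lifts of distinct types has an internal vertex. -/
theorem internal_pos_of_lifts {Q : QuadS} {L : Fin 3 → SPair} {τ : Fin 3 → LiftTy}
    (hτ : ∀ i j : Fin 3, i ≠ j → τ i ≠ τ j) (hcol : ∀ i, CollPairT (τ i) (L i) Q) :
    0 < Q.1.2 := by
  by_contra! h
  choose w hw using fun i => (hcol i).eq_wilson (Nat.le_zero.mp h)
  have hinj : Function.Injective w := fun i j hij => by
    by_contra hne
    exact hτ i j hne (by rw [hw, hw, hij])
  simpa using Fintype.card_le_of_injective w hinj

theorem CollPair.internal_pos {P : SPair} {Q : QuadS} (h : CollPair P Q) (hQ : 0 < Q.1.2) :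
    0 < P.1.2 := by
  rcases h with ⟨h, -⟩ | ⟨h, -⟩ <;> simp [h, hQ]

/- STATEMENT 3: Let `Γ` be a trivalent V-oriented Wilson graph, `e, f`
admissible edges (tokens `a`, `b`), `Γ_x = δ_e Γ` (the diagram `Q`), and let
`Γ_x^1, Γ_x^2, Γ_x^3` be the lifts of `Γ_x` (the three pairs `L i`, with
pairwise distinct splitting types `τ i`, through which every pair collapsing to
`Q` factors).  Then `δ_e Γ ∼ ε·δ_f Γ` (isomorphic as V-oriented Wilson graphs,
with orientation sign `ε`) iff for some `i ∈ {1,2,3}` there is a pair `(ρ, σ)`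
carrying `Γ` to `ε·Γ_x^i` with `σ f = e` — i.e. iff the pair `(Γ, f)` is
equivalent, with sign `ε`, to one of the three lift pairs. -/
theorem collapse_sign_iso_iff_lift (p : ℕ × ℕ) (Γ : Tri p.1 p.2)
    (a b : Γ.E ⊕ Fin p.1) (Q : QuadS)
    (hQ : CollPair ⟨p, ⟨Γ, a⟩⟩ Q)
    (L : Fin 3 → SPair) (τ : Fin 3 → LiftTy)
    (hτ : ∀ i j : Fin 3, i ≠ j → τ i ≠ τ j)
    (hcolT : ∀ i : Fin 3, CollPairT (τ i) (L i) Q)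
    (hcover : ∀ P : SPair, CollPair P Q → ∃ i : Fin 3, PairEquivS P (L i))
    (ε : ℤˣ) :
    (∃ Q' : QuadS, CollPair ⟨p, ⟨Γ, b⟩⟩ Q' ∧ QIsoSg ε Q Q') ↔
    (∃ i : Fin 3, PairEquivSg ε ⟨p, ⟨Γ, b⟩⟩ (L i)) := by
  have hpos : 0 < Q.1.2 := internal_pos_of_lifts hτ hcolT
  constructor
  · rintro ⟨Q', hc, hiso⟩
    obtain ⟨P, hP, hPQ⟩ := hc.exists_pairEquivSg (hc.internal_pos (hiso.1 ▸ hpos)) hiso.symm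
    obtain ⟨i, hi⟩ := hcover P hPQ
    exact ⟨i, mul_one ε ▸ hP.trans hi⟩
  · rintro ⟨i, hi⟩
    obtain ⟨Q', hiso, hc⟩ := (hcolT i).collPair.exists_qIsoSg hi.symm
    exact ⟨Q', hc, hiso⟩
end
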